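/- arXiv:2503.13727 — 2 statements merged into one kernel-verified Lean document; each statement's English description precedes it below -/
import Mathlib

section
/- There exists a set X ⊆ ℕ that is loquaciously high for descending sequences but not high for paths: some ill-founded computable tree has no X-computable path. -/
namespace CFT

open Nat.Partrec (Code)

/-- Relativized partial recursive functions: `f` is partial recursive in the
(total) oracle `O : ℕ → ℕ`.  This mirrors Mathlib's `Nat.Partrec`, with an
extra constructor for the oracle. -/
inductive RecursiveIn (O : ℕ → ℕ) : (ℕ →. ℕ) → Prop
  | zero : RecursiveIn O (pure 0)
  | succ : RecursiveIn O Nat.succ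
  | left : RecursiveIn O ↑fun n : ℕ => n.unpair.1
  | right : RecursiveIn O ↑fun n : ℕ => n.unpair.2
  | oracle : RecursiveIn O ↑O
  | pair {f g} : RecursiveIn O f → RecursiveIn O g →
      RecursiveIn O fun n => Nat.pair <$> f n <*> g n
  | comp {f g} : RecursiveIn O f → RecursiveIn O g →
      RecursiveIn O fun n => g n >>= f
  | prec {f g} : RecursiveIn O f → RecursiveIn O g →
      RecursiveIn O (Nat.unpaired fun a n =>
        n.rec (f a) fun y IH => do let i ← IH; g (Nat.pair a (Nat.pair y i)))
  | rfind {f} : RecursiveIn O f →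
      RecursiveIn O fun a => Nat.rfind fun n => (fun m => m = 0) <$> f (Nat.pair a n)

/-- Partial functions between `Primcodable` types that are partial recursive in
the oracle `O`. -/
def PartrecIn (O : ℕ → ℕ) {α σ : Type} [Primcodable α] [Primcodable σ] (f : α →. σ) : Prop :=
  RecursiveIn O fun n =>
    Part.bind (Part.ofOption (Encodable.decode (α := α) n)) fun a => (f a).map Encodable.encode

/-- Total functions between `Primcodable` types that are computable in the oracle `O`. -/
def ComputableIn (O : ℕ → ℕ) {α σ : Type} [Primcodable α] [Primcodable σ] (f : α → σ) : Prop :=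
  PartrecIn O (f : α →. σ)

open Classical in
/-- The characteristic function of a set of naturals. -/
noncomputable def chi (A : Set ℕ) : ℕ → ℕ := fun n => if n ∈ A then 1 else 0

/-- `A` is computably enumerable in (the characteristic function of) `X`. -/
def CEIn (X : Set ℕ) (A : Set ℕ) : Prop :=
  ∃ f : ℕ →. ℕ, PartrecIn (chi X) f ∧ ∀ n, n ∈ A ↔ (f n).Dom

/-- The `e`-th partial computable function `ℕ →. ℕ`. -/
def codeFn (e : ℕ) : ℕ →. ℕ := (Denumerable.ofNat Code e).eval

/-! ### Trees on ℕ -/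

def PrefixClosed (T : Set (List ℕ)) : Prop := ∀ l ∈ T, ∀ l' : List ℕ, l' <+: l → l' ∈ T

/-- Index `e` decides a (prefix-closed) tree on `ℕ`. -/
def DecidesTree (e : ℕ) : Prop :=
  (∀ n, (codeFn e n).Dom) ∧
    PrefixClosed {l : List ℕ | codeFn e (Encodable.encode l) = Part.some 1}

open Classical in
/-- The standard enumeration of computable trees on ℕ; indices that do not
decide a tree denote the empty tree. -/
noncomputable def treeAt (e : ℕ) : Set (List ℕ) :=
  if DecidesTree e then {l : List ℕ | codeFn e (Encodable.encode l) = Part.some 1} else ∅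

/-- `f` is a path through the tree `T`: every finite initial segment
`[f 0, …, f (k-1)]` is in `T`. -/
def IsPath (T : Set (List ℕ)) (f : ℕ → ℕ) : Prop := ∀ k, (List.range k).map f ∈ T

def IllFounded (T : Set (List ℕ)) : Prop := ∃ f, IsPath T f

/-- The set of indices of well-founded computable trees. -/
def WF : Set ℕ := {e | ¬ IllFounded (treeAt e)}

/-- `T` is a computable tree (prefix-closed and decided by a total computable function). -/
def ComputableTree (T : Set (List ℕ)) : Prop :=
  PrefixClosed T ∧ ∃ χ : List ℕ → Bool, Computable χ ∧ ∀ l, l ∈ T ↔ χ l = true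

/-! ### Highness notions for paths -/

def HighForPaths (X : Set ℕ) : Prop :=
  ∀ T : Set (List ℕ), ComputableTree T → IllFounded T →
    ∃ f : ℕ → ℕ, ComputableIn (chi X) f ∧ IsPath T f

def LoqHighForPaths (X : Set ℕ) : Prop :=
  ∃ F : ℕ × ℕ → ℕ, ComputableIn (chi X) F ∧
    ∀ e, IllFounded (treeAt e) → IsPath (treeAt e) fun n => F (e, n)

def UnifHighForPaths (X : Set ℕ) : Prop :=
  ∃ F : ℕ × ℕ →. ℕ, PartrecIn (chi X) F ∧
    ∀ e, IllFounded (treeAt e) →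
      ∃ g : ℕ → ℕ, IsPath (treeAt e) g ∧ ∀ n, F (e, n) = Part.some (g n)

def RetHighForPaths (X : Set ℕ) : Prop :=
  ∃ F : ℕ × ℕ →. ℕ, PartrecIn (chi X) F ∧
    (∀ e, IllFounded (treeAt e) →
      ∃ g : ℕ → ℕ, IsPath (treeAt e) g ∧ ∀ n, F (e, n) = Part.some (g n)) ∧
    (∀ e, ¬ IllFounded (treeAt e) → ∀ n, ¬ (F (e, n)).Dom)

/-! ### Σ¹₁ and Π¹₁ sets -/

def Sigma11 (A : Set ℕ) : Prop :=
  ∃ R : ℕ → List ℕ → Bool, Computable₂ R ∧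
    ∀ n, n ∈ A ↔ ∃ f : ℕ → ℕ, ∀ k, R n ((List.range k).map f) = true

def Pi11 (A : Set ℕ) : Prop := Sigma11 Aᶜ

/-! ### Linear orders -/

/-- A (presentation of a) linear order: a domain `D ⊆ ℕ` and a strict order
relation on it. -/
structure LinOrd where
  dom : Set ℕ
  lt : ℕ → ℕ → Prop

/-- `L` really is a strict linear order on its domain. -/
def LinOrd.IsValid (L : LinOrd) : Prop :=
  (∀ a b, L.lt a b → a ∈ L.dom ∧ b ∈ L.dom) ∧
  (∀ a, ¬ L.lt a a) ∧
  (∀ a b c, L.lt a b → L.lt b c → L.lt a c) ∧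
  (∀ a ∈ L.dom, ∀ b ∈ L.dom, a = b ∨ L.lt a b ∨ L.lt b a)

def linOrdOfCodes (n : ℕ) : LinOrd :=
  ⟨{a | codeFn n.unpair.1 a = Part.some 1},
   fun a b => codeFn n.unpair.2 (Nat.pair a b) = Part.some 1⟩

def DecidesLinOrd (n : ℕ) : Prop :=
  (∀ m, (codeFn n.unpair.1 m).Dom) ∧ (∀ m, (codeFn n.unpair.2 m).Dom) ∧
    (linOrdOfCodes n).IsValid

open Classical in
/-- The standard enumeration of computable linear orders; indices that do not
decide a linear order denote the empty order. -/
noncomputable def linOrdAt (n : ℕ) : LinOrd :=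
  if DecidesLinOrd n then linOrdOfCodes n else ⟨∅, fun _ _ => False⟩

def IsDescSeq (L : LinOrd) (f : ℕ → ℕ) : Prop :=
  ∀ i, f i ∈ L.dom ∧ L.lt (f (i + 1)) (f i)

def LinOrd.IllFounded (L : LinOrd) : Prop := ∃ f, IsDescSeq L f

/-- A tight descending sequence: a descending sequence that gets below every
descending sequence. -/
def IsTightDescSeq (L : LinOrd) (f : ℕ → ℕ) : Prop :=
  IsDescSeq L f ∧ ∀ g, IsDescSeq L g → ∀ n, ∃ m, L.lt (f m) (g n)

/-- `L` is a computable linear order. -/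
def ComputableLinOrd (L : LinOrd) : Prop :=
  L.IsValid ∧
  (∃ χ : ℕ → Bool, Computable χ ∧ ∀ a, a ∈ L.dom ↔ χ a = true) ∧
  (∃ χ : ℕ → ℕ → Bool, Computable₂ χ ∧ ∀ a b, L.lt a b ↔ χ a b = true)

def LoqHighForDS (X : Set ℕ) : Prop :=
  ∃ g : ℕ × ℕ → ℕ, ComputableIn (chi X) g ∧
    ∀ n, (linOrdAt n).IllFounded → IsDescSeq (linOrdAt n) fun k => g (n, k)

def HighForTightDS (X : Set ℕ) : Prop :=
  ∀ L : LinOrd, ComputableLinOrd L → L.IllFounded →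
    ∃ f : ℕ → ℕ, ComputableIn (chi X) f ∧ IsTightDescSeq L f

def UnifHighForTightDS (X : Set ℕ) : Prop :=
  ∃ F : ℕ × ℕ →. ℕ, PartrecIn (chi X) F ∧
    ∀ n, (linOrdAt n).IllFounded →
      ∃ g : ℕ → ℕ, IsTightDescSeq (linOrdAt n) g ∧ ∀ k, F (n, k) = Part.some (g k)

/-! ### Binary trees -/

def PrefixClosedB (B : Set (List Bool)) : Prop := ∀ l ∈ B, ∀ l' : List Bool, l' <+: l → l' ∈ B

def DecidesBTree (e : ℕ) : Prop :=
  (∀ n, (codeFn e n).Dom) ∧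
    PrefixClosedB {l : List Bool | codeFn e (Encodable.encode l) = Part.some 1}

open Classical in
/-- The standard enumeration of computable binary trees; indices that do not
decide a binary tree denote the full binary tree. -/
noncomputable def bTreeAt (e : ℕ) : Set (List Bool) :=
  if DecidesBTree e then {l : List Bool | codeFn e (Encodable.encode l) = Part.some 1}
  else Set.univ

def BInfinite (B : Set (List Bool)) : Prop := ∀ k, ∃ l ∈ B, l.length = k

def IsBPath (B : Set (List Bool)) (p : ℕ → Bool) : Prop := ∀ k, (List.range k).map p ∈ B



/-! ### A comparison game between two trees -/

section Game

/-- The initial segment of length `k` of `f`. -/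
def seg (f : ℕ → ℕ) (k : ℕ) : List ℕ := (List.range k).map f

theorem length_seg (f : ℕ → ℕ) (k : ℕ) : (seg f k).length = k := by simp [seg]

theorem seg_succ (f : ℕ → ℕ) (k : ℕ) : seg f (k + 1) = seg f k ++ [f k] := by
  simp [seg, List.range_succ]

theorem take_seg (f : ℕ → ℕ) (n k : ℕ) : (seg f k).take n = seg f (min n k) := by
  simp [seg, ← List.map_take, List.take_range]

theorem getD_seg {f : ℕ → ℕ} {i k : ℕ} (h : i < k) (d : ℕ) : (seg f k).getD i d = f i := by
  simp [seg, h]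

theorem seg_congr {f g : ℕ → ℕ} {k : ℕ} (h : ∀ i < k, f i = g i) : seg f k = seg g k := by
  simpa [seg] using h

/-- The moves with which the strategy `φ` of the second player answers the moves `x`. -/
def followMoves (φ : List ℕ → ℕ) (x : List ℕ) : List ℕ :=
  (List.range x.length).map fun i => φ (x.take (i + 1))

/-- The moves made by the strategy `ψ` of the first player against the answers `y`. -/
def leadMoves (ψ : List ℕ → ℕ) (y : List ℕ) : List ℕ :=
  (List.range (y.length + 1)).map fun i => ψ (y.take i)

theorem followMoves_concat (φ : List ℕ → ℕ) (x : List ℕ) (i : ℕ) :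
    followMoves φ (x ++ [i]) = followMoves φ x ++ [φ (x ++ [i])] := by
  simp only [followMoves, List.length_append, List.length_singleton, List.range_succ,
    List.map_append, List.map_cons, List.map_nil]
  congr 1
  · refine List.map_congr_left fun j hj => ?_
    rw [List.take_append_of_le_length (by simpa using hj)]
  · rw [List.take_of_length_le (by simp)]

theorem leadMoves_concat (ψ : List ℕ → ℕ) (y : List ℕ) (j : ℕ) :
    leadMoves ψ (y ++ [j]) = leadMoves ψ y ++ [ψ (y ++ [j])] := by
  rw [leadMoves, List.range_succ, List.map_append, leadMoves]
  simp only [List.length_append, List.length_singleton, List.map_cons, List.map_nil]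
  congr 1
  · refine List.map_congr_left fun j hj => ?_
    rw [List.take_append_of_le_length (by simpa [Nat.lt_succ_iff] using hj)]
  · rw [List.take_of_length_le (by simp)]

theorem leadMoves_nil (ψ : List ℕ → ℕ) : leadMoves ψ [] = [ψ []] := by simp [leadMoves]

theorem followMoves_congr {φ φ' : List ℕ → ℕ} {x : List ℕ}
    (h : ∀ i < x.length, φ (x.take (i + 1)) = φ' (x.take (i + 1))) :
    followMoves φ x = followMoves φ' x :=
  List.map_congr_left fun i hi => h i (by simpa using hi)

theorem leadMoves_congr {ψ ψ' : List ℕ → ℕ} {y : List ℕ}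
    (h : ∀ i ≤ y.length, ψ (y.take i) = ψ' (y.take i)) : leadMoves ψ y = leadMoves ψ' y :=
  List.map_congr_left fun i hi => h i (by simpa [Nat.lt_succ_iff] using hi)

/-- The second player has a strategy answering moves in `A` by moves in `B`. -/
def FollowerWins (A B : Set (List ℕ)) : Prop := ∃ φ, ∀ x ∈ A, followMoves φ x ∈ B

/-- The first player has a strategy that stays in `A` as long as the answers are in `B`. -/
def LeaderWins (A B : Set (List ℕ)) : Prop := ∃ ψ, ∀ y ∈ B, leadMoves ψ y ∈ A

/-- The positions from which the second player loses after finitely many moves. -/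
inductive FollowerLoses (A B : Set (List ℕ)) : List ℕ → List ℕ → Prop
  | stuck {x y} : x ∈ A → y ∉ B → FollowerLoses A B x y
  | move {x y} (i : ℕ) : (∀ j, FollowerLoses A B (x ++ [i]) (y ++ [j])) → FollowerLoses A B x y

variable {A B : Set (List ℕ)}

theorem FollowerLoses.mem (hA : PrefixClosed A) {x y : List ℕ} (h : FollowerLoses A B x y) :
    x ∈ A := by
  induction h with
  | stuck hx _ => exact hx
  | move i _ ih => exact hA _ (ih 0) _ (List.prefix_append _ _)

theorem leaderWins_of_followerLoses (hA : PrefixClosed A) (hB : PrefixClosed B)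
    (h : FollowerLoses A B [] []) : LeaderWins A B := by
  have key : ∀ x y, FollowerLoses A B x y → y ∈ B →
      ∃ i, ∀ j, FollowerLoses A B (x ++ [i]) (y ++ [j]) := by
    rintro x y (⟨_, hy⟩ | ⟨i, hi⟩) hB
    exacts [absurd hB hy, ⟨i, hi⟩]
  choose! s hs using key
  let X : List ℕ → List ℕ := fun l => l.reverseRecOn [] fun y _ x => x ++ [s x y]
  have hX0 : X [] = [] := by simp [X]
  have hX : ∀ y j, X (y ++ [j]) = X y ++ [s (X y) y] := fun y j => by simp [X]
  have hlose : ∀ y : List ℕ, ∀ j, y ∈ B → FollowerLoses A B (X y ++ [s (X y) y]) (y ++ [j]) := by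
    intro y
    induction y using List.reverseRecOn with
    | nil => intro j hy; rw [hX0]; exact hs _ _ h hy j
    | append_singleton y i ih =>
      intro j hy
      refine hs _ _ ?_ hy j
      rw [hX]
      exact ih i (hB _ hy _ (List.prefix_append _ _))
  have hmoves : ∀ y, leadMoves (fun y => s (X y) y) y = X y ++ [s (X y) y] := by
    intro y
    induction y using List.reverseRecOn with
    | nil => rw [leadMoves_nil, hX0]; rfl
    | append_singleton y i ih => rw [leadMoves_concat, ih, hX]
  exact ⟨fun y => s (X y) y, fun y hy => hmoves y ▸ (hlose y 0 hy).mem hA⟩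

theorem followerWins_of_not_followerLoses (h : ¬ FollowerLoses A B [] []) :
    FollowerWins A B := by
  have key : ∀ x y i, ¬ FollowerLoses A B x y →
      ∃ j, ¬ FollowerLoses A B (x ++ [i]) (y ++ [j]) := by
    intro x y i h
    by_contra! hc
    exact h (.move i hc)
  choose! s hs using key
  let Y : List ℕ → List ℕ := fun l => l.reverseRecOn [] fun x i y => y ++ [s x y i]
  have hY0 : Y [] = [] := by simp [Y]
  have hY : ∀ x i, Y (x ++ [i]) = Y x ++ [s x (Y x) i] := fun y j => by simp [Y]
  have hlose : ∀ x, ¬ FollowerLoses A B x (Y x) := by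
    intro x
    induction x using List.reverseRecOn with
    | nil => rwa [hY0]
    | append_singleton x i ih => rw [hY]; exact hs _ _ _ ih
  have hmoves : ∀ x, followMoves (fun x => s x.dropLast (Y x.dropLast) (x.getLastD 0)) x = Y x := by
    intro x
    induction x using List.reverseRecOn with
    | nil => rw [hY0]; rfl
    | append_singleton x i ih => rw [followMoves_concat, ih, hY]; simp
  refine ⟨fun x => s x.dropLast (Y x.dropLast) (x.getLastD 0), fun x hx => ?_⟩
  rw [hmoves]
  by_contra hc
  exact hlose x (.stuck hx hc)

theorem followerWins_or_leaderWins (hA : PrefixClosed A) (hB : PrefixClosed B) :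
    FollowerWins A B ∨ LeaderWins A B := by
  by_cases h : FollowerLoses A B [] []
  · exact .inr (leaderWins_of_followerLoses hA hB h)
  · exact .inl (followerWins_of_not_followerLoses h)

theorem FollowerWins.of_illFounded (h : IllFounded B) : FollowerWins A B := by
  obtain ⟨f, hf⟩ := h
  refine ⟨fun x => f (x.length - 1), fun x _ => ?_⟩
  convert hf x.length using 1
  refine List.map_congr_left fun i hi => ?_
  have : i < x.length := by simpa using hi
  simp only [List.length_take]
  congr 1
  omega

theorem LeaderWins.of_illFounded (h : IllFounded A) : LeaderWins A B := by
  obtain ⟨f, hf⟩ := h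
  refine ⟨fun x => f x.length, fun y _ => ?_⟩
  convert hf (y.length + 1) using 1
  refine List.map_congr_left fun i hi => ?_
  have : i < y.length + 1 := by simpa using hi
  simp only [List.length_take]
  congr 1
  omega

theorem FollowerWins.illFounded (hF : FollowerWins A B) (hL : LeaderWins A B)
    (hA : [] ∈ A) (hB : [] ∈ B) : IllFounded A ∧ IllFounded B := by
  obtain ⟨φ, hφ⟩ := hF
  obtain ⟨ψ, hψ⟩ := hL
  let z : ℕ → List ℕ × List ℕ := fun n =>
    n.rec ([], []) fun _ p => (p.1 ++ [ψ p.2], p.2 ++ [φ (p.1 ++ [ψ p.2])])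
  let a : ℕ → ℕ := fun n => ψ (z n).2
  let b : ℕ → ℕ := fun n => φ ((z n).1 ++ [ψ (z n).2])
  have hz : ∀ n, z n = (seg a n, seg b n) := by
    intro n
    induction n with
    | zero => rfl
    | succ n ih =>
      have : z (n + 1) = ((z n).1 ++ [a n], (z n).2 ++ [b n]) := rfl
      rw [this, ih, seg_succ, seg_succ]
  have ha' : ∀ n, a n = ψ (seg b n) := fun n => congrArg (ψ ·.2) (hz n)
  have hb' : ∀ n, b n = φ (seg a n ++ [a n]) := fun n => congrArg (φ <| ·.1 ++ [a n]) (hz n)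
  have hb : ∀ n, followMoves φ (seg a n) = seg b n := by
    intro n
    induction n with
    | zero => rfl
    | succ n ih =>
      rw [seg_succ, followMoves_concat, ih, seg_succ, hb']
  have ha : ∀ n, leadMoves ψ (seg b n) = seg a (n + 1) := by
    intro n
    induction n with
    | zero => exact leadMoves_nil ψ
    | succ n ih =>
      rw [seg_succ b, leadMoves_concat, ih, seg_succ a (n + 1), ← seg_succ b, ← ha']
  have hAB : ∀ n, seg a n ∈ A ∧ seg b n ∈ B := by
    intro n
    induction n with
    | zero => exact ⟨hA, hB⟩
    | succ n ih =>
      have : seg a (n + 1) ∈ A := ha n ▸ hψ _ ih.2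
      exact ⟨this, hb (n + 1) ▸ hφ _ this⟩
  exact ⟨⟨a, fun n => (hAB n).1⟩, ⟨b, fun n => (hAB n).2⟩⟩

end Game

/-! ### Trees given by conditions on initial segments -/

section PrefixTree

open Encodable Denumerable

/-- The tree of all lists whose initial segments all satisfy `K`. -/
def prefixTree (K : List ℕ → Prop) : Set (List ℕ) := {l | ∀ n < l.length + 1, K (l.take n)}

theorem prefixClosed_prefixTree (K : List ℕ → Prop) : PrefixClosed (prefixTree K) := by
  rintro l hl l' hl' n hn
  have := hl'.length_le
  rw [List.prefix_iff_eq_take.1 hl', List.take_take, min_eq_left (by omega)]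
  exact hl n (by omega)

theorem isPath_prefixTree {K : List ℕ → Prop} {f : ℕ → ℕ} :
    IsPath (prefixTree K) f ↔ ∀ k, K (seg f k) := by
  refine ⟨fun h k => ?_, fun h k n _ => ?_⟩
  · have := h k k (by simp)
    rwa [List.take_of_length_le (by simp)] at this
  · change K ((seg f k).take n)
    rw [take_seg]
    exact h _

theorem primrecPred_imp {α : Type} [Primcodable α] {p q : α → Prop} (hp : PrimrecPred p)
    (hq : PrimrecPred q) : PrimrecPred fun a => p a → q a :=
  (hp.not.or hq).of_eq fun _ => imp_iff_not_or.symm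

/-- Bounded quantification preserves primitive recursiveness. -/
theorem primrecPred_forall_lt {α : Type} [Primcodable α] {g : α → ℕ} {p : α → ℕ → Prop}
    (hg : Primrec g) (hp : PrimrecPred fun a : α × ℕ => p a.1 a.2) :
    PrimrecPred fun a => ∀ n < g a, p a n := by
  have : PrimrecRel fun n a => p a n := hp.comp (Primrec.snd.pair Primrec.fst)
  exact (this.forall_mem_list.comp (Primrec.list_range.comp hg) .id).of_eq (by simp)

theorem primrecPred_mem_prefixTree {α : Type} [Primcodable α] {K : α → List ℕ → Prop}
    (hK : PrimrecPred fun a : α × List ℕ => K a.1 a.2) :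
    PrimrecPred fun a : α × List ℕ => a.2 ∈ prefixTree (K a.1) :=
  primrecPred_forall_lt (Primrec.succ.comp (Primrec.list_length.comp .snd))
    (hK.comp ((Primrec.fst.comp .fst).pair
      (Primrec.list_take.comp .snd (Primrec.snd.comp .fst))))

theorem computableTree_prefixTree {K : List ℕ → Prop} (hK : PrimrecPred K) :
    ComputableTree (prefixTree K) := by
  have : PrimrecPred fun l : List ℕ => l ∈ prefixTree K :=
    (primrecPred_mem_prefixTree (α := Unit) (K := fun _ => K) (hK.comp .snd)).comp
      ((Primrec.const ()).pair .id)
  obtain ⟨_, h⟩ := this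
  exact ⟨prefixClosed_prefixTree K, _, h.to_comp, fun l => by simp⟩

end PrefixTree

/-! ### The diagonalizing tree -/

section Diagonal

open Encodable Denumerable

/-- Above the string coded in `e`, no string of length and code bounded by the length of `η` and
dominating `η` makes the functional coded in `e` output, at argument `pair e 0`, a value whose
being zero is decided by `b`. -/
def Avoids (b : Bool) (e : ℕ) (η : List ℕ) : Prop :=
  (ofNat (List ℕ) η.length.unpair.1).length ≤ η.length →
  (∀ i < (ofNat (List ℕ) η.length.unpair.1).length,
    η.getD i 0 ≤ (ofNat (List ℕ) η.length.unpair.1).getD i 0) →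
  (Code.evaln η.length (ofNat Code e.unpair.1)
    (Nat.pair (encode (ofNat (List ℕ) e.unpair.2 ++ ofNat (List ℕ) η.length.unpair.1))
      (Nat.pair e 0))).map (fun w => decide (w = 0)) ≠ some b

theorem primrecPred_avoids (b : Bool) :
    PrimrecPred fun a : ℕ × List ℕ => Avoids b a.1 a.2 := by
  have hlen : Primrec fun a : ℕ × List ℕ => a.2.length := Primrec.list_length.comp .snd
  have hρ : Primrec fun a : ℕ × List ℕ => ofNat (List ℕ) a.2.length.unpair.1 :=
    (Primrec.ofNat _).comp (Primrec.fst.comp (Primrec.unpair.comp hlen))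
  have hρlen := Primrec.list_length.comp hρ
  refine primrecPred_imp (Primrec.nat_le.comp hρlen hlen) (primrecPred_imp ?_ ?_)
  · exact primrecPred_forall_lt hρlen (Primrec.nat_le.comp
      ((Primrec.list_getD 0).comp (Primrec.snd.comp .fst) .snd)
      ((Primrec.list_getD 0).comp (hρ.comp .fst) .snd))
  · have he := Primrec.unpair.comp (Primrec.fst : Primrec fun a : ℕ × List ℕ => a.1)
    have hσ := (Primrec.ofNat (List ℕ)).comp (Primrec.snd.comp he)
    have hc := (Primrec.ofNat Code).comp (Primrec.fst.comp he)
    have harg := Primrec₂.natPair.comp (Primrec.encode.comp (Primrec.list_append.comp hσ hρ))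
      (Primrec₂.natPair.comp (Primrec.fst : Primrec fun a : ℕ × List ℕ => a.1) (Primrec.const 0))
    have hev := Nat.Partrec.Code.primrec_evaln.comp ((hlen.pair hc).pair harg)
    have hz : PrimrecPred fun a : (ℕ × List ℕ) × ℕ => a.2 = 0 :=
      Primrec.eq.comp .snd (.const 0)
    exact (Primrec.eq.comp (Primrec.option_map hev hz.decide.to₂) (.const (some b))).not

theorem avoids_nil (b : Bool) (e : ℕ) : Avoids b e [] := by simp [Avoids, Code.evaln]

/-- The tree of attempts at forcing the functional coded in `e` to avoid `b`. -/
def avoidTree (b : Bool) (e : ℕ) : Set (List ℕ) := prefixTree (Avoids b e)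

theorem nil_mem_avoidTree (b : Bool) (e : ℕ) : [] ∈ avoidTree b e := by
  simp [avoidTree, prefixTree, avoids_nil]

theorem avoids_of_illFounded {b : Bool} {c : Code} {σ : List ℕ}
    (h : IllFounded (avoidTree b (Nat.pair (encode c) (encode σ)))) :
    ∃ f : ℕ → ℕ, ∀ ρ : List ℕ, (∀ i < ρ.length, f i ≤ ρ.getD i 0) →
      ∀ w ∈ c.eval (Nat.pair (encode (σ ++ ρ))
        (Nat.pair (Nat.pair (encode c) (encode σ)) 0)), decide (w = 0) ≠ b := by
  obtain ⟨f, hf⟩ := h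
  rw [avoidTree, isPath_prefixTree] at hf
  refine ⟨f, fun ρ hρ w hw => ?_⟩
  obtain ⟨s, hs⟩ := Code.evaln_complete.1 hw
  have h1 : s + ρ.length ≤ Nat.pair (encode ρ) (s + ρ.length) := Nat.right_le_pair _ _
  have := hf (Nat.pair (encode ρ) (s + ρ.length))
  simp only [Avoids, length_seg, Nat.unpair_pair, ofNat_encode] at this
  have := this (by omega) fun i hi => by
    rw [getD_seg (by omega)]
    exact hρ i hi
  rw [Option.mem_def.1 (Code.evaln_mono (show s ≤ _ by omega) hs)] at this
  simpa using this

theorem exists_of_not_illFounded {b : Bool} {c : Code} {σ : List ℕ}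
    (h : ¬ IllFounded (avoidTree b (Nat.pair (encode c) (encode σ)))) (f : ℕ → ℕ) :
    ∃ ρ : List ℕ, (∀ i < ρ.length, f i ≤ ρ.getD i 0) ∧
      ∃ w ∈ c.eval (Nat.pair (encode (σ ++ ρ))
        (Nat.pair (Nat.pair (encode c) (encode σ)) 0)), decide (w = 0) = b := by
  have : ¬ ∀ k, Avoids b _ (seg f k) := fun hf => h ⟨f, isPath_prefixTree.2 hf⟩
  push Not at this
  obtain ⟨k, hk⟩ := this
  simp only [Avoids, length_seg, Nat.unpair_pair, ofNat_encode] at hk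
  push Not at hk
  obtain ⟨h1, h2, h3⟩ := hk
  refine ⟨ofNat (List ℕ) k.unpair.1, fun i hi => ?_, ?_⟩
  · have := h2 i hi
    rwa [getD_seg (by omega)] at this
  · obtain ⟨w, hw, hb⟩ := Option.map_eq_some_iff.1 h3
    exact ⟨w, Code.evaln_sound hw, hb⟩

/-- The condition on `l` to be, at the argument `x`, a winning strategy in the comparison game
between the two avoidance trees for `e`, as far as `l` is long enough to tell; the entry at
`pair e 0` says which player the strategy is for. -/
def RespectsAt (l : List ℕ) (e : ℕ) (x : List ℕ) : Prop :=
  (∀ i < x.length + 1, Nat.pair e (encode (x.take i)) < l.length) →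
  if l.getD (Nat.pair e 0) 0 = 0 then
    x ∈ avoidTree false e →
      followMoves (fun y => l.getD (Nat.pair e (encode y)) 0 - 1) x ∈ avoidTree true e
  else
    x ∈ avoidTree true e →
      leadMoves (fun y => l.getD (Nat.pair e (encode y)) 0 - 1) x ∈ avoidTree false e

/-- The condition `RespectsAt` for the index and the argument coded by the length of `l`. -/
def Respects (l : List ℕ) : Prop :=
  RespectsAt l l.length.unpair.1.unpair.1 (ofNat (List ℕ) l.length.unpair.1.unpair.2)

theorem primrecPred_respectsAt :
    PrimrecPred fun a : List ℕ × ℕ × List ℕ => RespectsAt a.1 a.2.1 a.2.2 := by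
  have hl : Primrec fun a : List ℕ × ℕ × List ℕ => a.1 := .fst
  have he : Primrec fun a : List ℕ × ℕ × List ℕ => a.2.1 := Primrec.fst.comp .snd
  have hx : Primrec fun a : List ℕ × ℕ × List ℕ => a.2.2 := Primrec.snd.comp .snd
  have hxlen := Primrec.list_length.comp hx
  have hpos {g : (List ℕ × ℕ × List ℕ) × ℕ → ℕ} (hg : Primrec g) :
      Primrec fun b : (List ℕ × ℕ × List ℕ) × ℕ =>
        Nat.pair b.1.2.1 (encode (b.1.2.2.take (g b))) :=
    Primrec₂.natPair.comp (he.comp .fst)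
      (Primrec.encode.comp (Primrec.list_take.comp hg (hx.comp .fst)))
  have hlook {g : (List ℕ × ℕ × List ℕ) × ℕ → ℕ} (hg : Primrec g) :
      Primrec₂ fun (a : List ℕ × ℕ × List ℕ) (i : ℕ) =>
        a.1.getD (Nat.pair a.2.1 (encode (a.2.2.take (g (a, i))))) 0 - 1 :=
    Primrec.pred.comp ((Primrec.list_getD 0).comp (hl.comp .fst) (hpos hg))
  have hfollow := Primrec.list_map (Primrec.list_range.comp hxlen)
    (hlook (Primrec.succ.comp .snd))
  have hlead := Primrec.list_map (Primrec.list_range.comp (Primrec.succ.comp hxlen))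
    (hlook .snd)
  have hmem {g : List ℕ × ℕ × List ℕ → List ℕ} (b : Bool) (hg : Primrec g) :
      PrimrecPred fun a => g a ∈ avoidTree b a.2.1 :=
    (primrecPred_mem_prefixTree (primrecPred_avoids b)).comp (he.pair hg)
  have hz : PrimrecPred fun a : List ℕ × ℕ × List ℕ => a.1.getD (Nat.pair a.2.1 0) 0 = 0 :=
    Primrec.eq.comp ((Primrec.list_getD 0).comp hl (Primrec₂.natPair.comp he (.const 0)))
      (.const 0)
  refine primrecPred_imp (primrecPred_forall_lt (Primrec.succ.comp hxlen)
    (Primrec.nat_lt.comp (hpos .snd) (Primrec.list_length.comp (hl.comp .fst)))) ?_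
  refine ((primrecPred_imp hz (primrecPred_imp (hmem false hx) (hmem true hfollow))).and
    (primrecPred_imp hz.not (primrecPred_imp (hmem true hx) (hmem false hlead)))).of_eq
      fun a => ?_
  split_ifs with h
  · exact ⟨fun H => H.1 h, fun H => ⟨fun _ => H, fun h' => absurd h h'⟩⟩
  · exact ⟨fun H => H.2 h, fun H => ⟨fun h' => absurd h' h, fun _ => H⟩⟩

theorem primrecPred_respects : PrimrecPred Respects := by
  have hu := Primrec.unpair.comp (Primrec.fst.comp (Primrec.unpair.comp
    (Primrec.list_length (α := ℕ))))
  exact primrecPred_respectsAt.comp (Primrec.id.pair ((Primrec.fst.comp hu).pair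
    ((Primrec.ofNat (List ℕ)).comp (Primrec.snd.comp hu))))

theorem isPath_respects {P : ℕ → ℕ} : IsPath (prefixTree Respects) P ↔
    ∀ e x, if P (Nat.pair e 0) = 0 then
      x ∈ avoidTree false e → followMoves (fun y => P (Nat.pair e (encode y)) - 1) x
        ∈ avoidTree true e
    else
      x ∈ avoidTree true e → leadMoves (fun y => P (Nat.pair e (encode y)) - 1) x
        ∈ avoidTree false e := by
  have key (e k : ℕ) (x : List ℕ)
      (hk : ∀ i < x.length + 1, Nat.pair e (encode (x.take i)) < k) :
      followMoves (fun y => (seg P k).getD (Nat.pair e (encode y)) 0 - 1) x =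
        followMoves (fun y => P (Nat.pair e (encode y)) - 1) x ∧
      leadMoves (fun y => (seg P k).getD (Nat.pair e (encode y)) 0 - 1) x =
        leadMoves (fun y => P (Nat.pair e (encode y)) - 1) x ∧
      (seg P k).getD (Nat.pair e 0) 0 = P (Nat.pair e 0) :=
    ⟨followMoves_congr fun i hi => by rw [getD_seg (hk _ (by omega))],
      leadMoves_congr fun i hi => by rw [getD_seg (hk _ (by omega))],
      getD_seg (by simpa using hk 0 (by omega)) _⟩
  rw [isPath_prefixTree]
  constructor
  · intro h e x
    obtain ⟨s, hs⟩ : ∃ s, ∀ i < x.length + 1, Nat.pair e (encode (x.take i)) < s := by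
      refine ⟨((Finset.range (x.length + 1)).sup fun i => Nat.pair e (encode (x.take i))) + 1,
        fun i hi => Nat.lt_succ_of_le ?_⟩
      exact Finset.le_sup (f := fun i => Nat.pair e (encode (x.take i))) (by simpa using hi)
    have hk i hi := (hs i hi).trans_le (Nat.right_le_pair (Nat.pair e (encode x)) s)
    have := h (Nat.pair (Nat.pair e (encode x)) s)
    simp only [Respects, RespectsAt, length_seg, Nat.unpair_pair, ofNat_encode] at this
    obtain ⟨h1, h2, h3⟩ := key e _ x hk
    have := this hk
    rwa [h1, h2, h3] at this
  · intro h k hk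
    simp only [length_seg] at hk ⊢
    obtain ⟨h1, h2, h3⟩ := key _ _ _ hk
    rw [h1, h2, h3]
    exact h _ _

theorem IsPath.followerWins {P : ℕ → ℕ} (h : IsPath (prefixTree Respects) P) {e : ℕ}
    (he : P (Nat.pair e 0) = 0) : FollowerWins (avoidTree false e) (avoidTree true e) :=
  ⟨_, fun x => by simpa only [he, if_true] using isPath_respects.1 h e x⟩

theorem IsPath.leaderWins {P : ℕ → ℕ} (h : IsPath (prefixTree Respects) P) {e : ℕ}
    (he : P (Nat.pair e 0) ≠ 0) : LeaderWins (avoidTree false e) (avoidTree true e) :=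
  ⟨_, fun x => by simpa only [he, if_false] using isPath_respects.1 h e x⟩

theorem illFounded_respects : IllFounded (prefixTree Respects) := by
  have key : ∀ e, ∃ p : List ℕ → ℕ, ∀ x, if p [] = 0 then
      x ∈ avoidTree false e → followMoves (fun y => p y - 1) x ∈ avoidTree true e
    else
      x ∈ avoidTree true e → leadMoves (fun y => p y - 1) x ∈ avoidTree false e := by
    intro e
    rcases followerWins_or_leaderWins (prefixClosed_prefixTree (Avoids false e))
      (prefixClosed_prefixTree (Avoids true e)) with ⟨φ, hφ⟩ | ⟨ψ, hψ⟩
    · refine ⟨fun x => if x = [] then 0 else φ x + 1, fun x => ?_⟩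
      rw [if_pos (if_pos rfl)]
      intro hx
      refine (?_ : followMoves _ x = followMoves φ x) ▸ hφ x hx
      refine followMoves_congr fun i hi => ?_
      have : x.take (i + 1) ≠ [] := fun h => by
        have := congrArg List.length h
        rw [List.length_take, List.length_nil] at this
        omega
      simp [this]
    · exact ⟨fun x => ψ x + 1, fun x => hψ x⟩
  choose p hp using key
  refine ⟨fun m => p m.unpair.1 (ofNat (List ℕ) m.unpair.2), isPath_respects.2 fun e x => ?_⟩
  simpa using hp e x

/-- If the functional coded in `e` cannot be made undefined at `pair e 0`, then one of the two
outcomes there can neither be avoided nor occur on a path. -/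
theorem exists_outcome {e : ℕ} {b : Bool} (h : ¬ IllFounded (avoidTree b e)) :
    ∃ v : Bool, ¬ IllFounded (avoidTree v e) ∧
      ∀ P, IsPath (prefixTree Respects) P → decide (P (Nat.pair e 0) = 0) ≠ v := by
  by_cases hF : FollowerWins (avoidTree false e) (avoidTree true e)
  · have hL : ¬ LeaderWins (avoidTree false e) (avoidTree true e) := fun hL => by
      have := hF.illFounded hL (nil_mem_avoidTree _ _) (nil_mem_avoidTree _ _)
      cases b
      exacts [h this.1, h this.2]
    exact ⟨false, fun hi => hL (.of_illFounded hi),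
      fun P hP hv => hL (hP.leaderWins (by simpa using hv))⟩
  · exact ⟨true, fun hi => hF (.of_illFounded hi),
      fun P hP hv => hF (hP.followerWins (by simpa using hv))⟩

end Diagonal

/-! ### Dominating functions that do not compute a path -/

section Forcing

open Encodable Denumerable

theorem seg_add (f : ℕ → ℕ) (m k : ℕ) :
    seg f (m + k) = seg f m ++ seg (fun i => f (m + i)) k := by
  simp [seg, List.range_add, Function.comp_def]

/-- The functional with code `c`, which reads initial segments of its oracle, computes `P`
from `f`. -/
def Computes (c : Code) (f P : ℕ → ℕ) : Prop :=
  ∀ n, (∃ k₀, ∀ k ≥ k₀, P n ∈ c.eval (Nat.pair (encode (seg f k)) n)) ∧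
    ∀ k, ∀ w ∈ c.eval (Nat.pair (encode (seg f k)) n), w = P n

/-- `f` agrees with `p.1` below `p.2` and dominates it from there on. -/
def Meets (p : (ℕ → ℕ) × ℕ) (f : ℕ → ℕ) : Prop :=
  (∀ i < p.2, f i = p.1 i) ∧ ∀ i, p.2 ≤ i → p.1 i ≤ f i

theorem exists_extension (p : (ℕ → ℕ) × ℕ) (c : Code) :
    ∃ q : (ℕ → ℕ) × ℕ, Meets p q.1 ∧ p.2 < q.2 ∧
      ∀ f, Meets q f → ∀ P, IsPath (prefixTree Respects) P → ¬ Computes c f P := by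
  obtain ⟨g, m⟩ := p
  by_cases h : ∃ b, ¬ IllFounded (avoidTree b (Nat.pair (encode c) (encode (seg g m))))
  · obtain ⟨b, hb⟩ := h
    obtain ⟨v, hv, hP⟩ := exists_outcome hb
    obtain ⟨ρ, hρ, w, hw, hwv⟩ := exists_of_not_illFounded hv fun i => g (m + i)
    let g' : ℕ → ℕ := fun i =>
      if i < m then g i else if i < m + ρ.length then ρ.getD (i - m) 0 else g i
    have hg' : seg g' (m + ρ.length) = seg g m ++ ρ := by
      rw [seg_add]
      congr 1
      · exact seg_congr fun i hi => by simp [g', hi]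
      · refine List.ext_getElem (by simp [seg]) fun i _ hi => ?_
        simp [g', seg, hi]
    refine ⟨(g', m + ρ.length + 1), ⟨fun i hi => by simp [g', hi], fun i hi => ?_⟩,
      by simp only; omega, fun f hf P hPath hc => ?_⟩
    · simp only [g', if_neg (not_lt.2 hi)]
      split_ifs with hi'
      · have := hρ (i - m) (by simp only at hi; omega)
        rwa [Nat.add_sub_cancel' hi] at this
      · exact le_rfl
    · have hfg : seg f (m + ρ.length) = seg g m ++ ρ :=
        hg' ▸ seg_congr fun i hi => hf.1 i (by simp only; omega)
      rw [← hfg] at hw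
      exact hP P hPath ((hc _).2 _ w hw ▸ hwv)
  · push Not at h
    choose s hs using fun b => avoids_of_illFounded (h b)
    refine ⟨(fun i => if i < m then g i else
      max (g i) (max (s true (i - m)) (s false (i - m))), m + 1),
      ⟨fun i hi => by simp_all, fun i hi => by simp [not_lt.2 hi]⟩, by simp,
      fun f hf P _ hc => ?_⟩
    have hle : ∀ i, m ≤ i → max (s true (i - m)) (s false (i - m)) ≤ f i := by
      intro i hi
      rcases lt_or_ge i (m + 1) with h' | h'
      · rw [hf.1 i h']
        simp [not_lt.2 hi]
      · refine le_trans ?_ (hf.2 i h')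
        simp [not_lt.2 hi]
    obtain ⟨⟨k, hk⟩, -⟩ := hc (Nat.pair (Nat.pair (encode c) (encode (seg g m))) 0)
    have hw := hk (m + k) (by omega)
    have hfg : seg f m = seg g m := seg_congr fun i hi => by
      rw [hf.1 i (by simp only; omega)]
      simp [hi]
    rw [seg_add, hfg] at hw
    refine hs _ _ (fun i hi => ?_) _ hw rfl
    rw [length_seg] at hi
    rw [getD_seg hi]
    have := hle (m + i) (by omega)
    rw [Nat.add_sub_cancel_left] at this
    rcases decide (P _ = 0) with _ | _
    exacts [(le_max_right _ _).trans this, (le_max_left _ _).trans this]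

theorem exists_dominating_not_computes (F : ℕ → ℕ) : ∃ f : ℕ → ℕ, (∀ n, F n ≤ f n) ∧
    ∀ c P, IsPath (prefixTree Respects) P → ¬ Computes c f P := by
  choose! q hq hlt hqc using exists_extension
  let r : ℕ → (ℕ → ℕ) × ℕ := fun n => n.rec (F, 0) fun n p => q p (ofNat Code n)
  have hr : ∀ n, r (n + 1) = q (r n) (ofNat Code n) := fun _ => rfl
  have hmono : StrictMono fun n => (r n).2 := strictMono_nat_of_lt_succ fun n => hlt _ _
  have hmeets : ∀ n d, Meets (r n) (r (n + d)).1 := by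
    intro n d
    induction d with
    | zero => exact ⟨fun _ _ => rfl, fun _ _ => le_rfl⟩
    | succ d ih =>
      have := hq (r (n + d)) (ofNat Code (n + d))
      rw [← hr] at this
      have hle : (r n).2 ≤ (r (n + d)).2 := hmono.monotone (by omega)
      refine ⟨fun i hi => (this.1 i (by omega)).trans (ih.1 i hi), fun i hi => ?_⟩
      refine (ih.2 i hi).trans ?_
      rcases lt_or_ge i (r (n + d)).2 with h | h
      exacts [(this.1 i h).ge, this.2 i h]
  let f : ℕ → ℕ := fun i => (r (i + 1)).1 i
  have hf : ∀ n, Meets (r n) f := by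
    intro n
    refine ⟨fun i hi => ?_, fun i hi => ?_⟩
    · rcases le_total n (i + 1) with h | h
      · obtain ⟨d, hd⟩ := Nat.exists_eq_add_of_le h
        have := (hmeets n d).1 i hi
        rwa [← hd] at this
      · obtain ⟨d, hd⟩ := Nat.exists_eq_add_of_le h
        have h1 : i + 1 ≤ (r (i + 1)).2 := hmono.le_apply
        have := (hmeets (i + 1) d).1 i (by omega)
        rw [← hd] at this
        exact this.symm
    · have h1 : n ≤ (r n).2 := hmono.le_apply
      obtain ⟨d, hd⟩ := Nat.exists_eq_add_of_le (show n ≤ i + 1 by omega)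
      have := (hmeets n d).2 i hi
      rwa [← hd] at this
  refine ⟨f, fun n => (hf 0).2 n (Nat.zero_le _), fun c P hP => ?_⟩
  have h := hr (encode c)
  rw [ofNat_encode] at h
  exact hqc (r (encode c)) c f (h ▸ hf (encode c + 1)) P hP

end Forcing

/-! ### Relative computability -/

section Oracle

open Encodable Denumerable

variable {O : ℕ → ℕ}

theorem RecursiveIn.of_partrec {f : ℕ →. ℕ} (hf : Nat.Partrec f) : RecursiveIn O f := by
  induction hf with
  | zero => exact .zero
  | succ => exact .succ
  | left => exact .left
  | right => exact .right
  | pair _ _ hf hg => exact .pair hf hg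
  | comp _ _ hf hg => exact .comp hf hg
  | prec _ _ hf hg => exact .prec hf hg
  | rfind _ hf => exact .rfind hf

theorem RecursiveIn.of_computable {f : ℕ → ℕ} (hf : Computable f) :
    RecursiveIn O (f : ℕ →. ℕ) :=
  .of_partrec (Partrec.nat_iff.1 hf)

theorem RecursiveIn.comp_total {f g : ℕ → ℕ} (hf : RecursiveIn O (f : ℕ →. ℕ))
    (hg : RecursiveIn O (g : ℕ →. ℕ)) : RecursiveIn O ((fun n => f (g n) : ℕ → ℕ) : ℕ →. ℕ) := by
  have : ((fun n => f (g n) : ℕ → ℕ) : ℕ →. ℕ) = fun n => (g : ℕ →. ℕ) n >>= (f : ℕ →. ℕ) := by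
    funext n
    exact (Part.bind_some (g n) (f : ℕ →. ℕ)).symm
  exact this ▸ hf.comp hg

theorem RecursiveIn.pair_total {f g : ℕ → ℕ} (hf : RecursiveIn O (f : ℕ →. ℕ))
    (hg : RecursiveIn O (g : ℕ →. ℕ)) :
    RecursiveIn O ((fun n => Nat.pair (f n) (g n) : ℕ → ℕ) : ℕ →. ℕ) := by
  have : ((fun n => Nat.pair (f n) (g n) : ℕ → ℕ) : ℕ →. ℕ) =
      fun n => Nat.pair <$> (f : ℕ →. ℕ) n <*> (g : ℕ →. ℕ) n := by
    funext n
    simp [Seq.seq]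
  exact this ▸ hf.pair hg

theorem RecursiveIn.prec_total {f g : ℕ → ℕ} (hf : RecursiveIn O (f : ℕ →. ℕ))
    (hg : RecursiveIn O (g : ℕ →. ℕ)) :
    RecursiveIn O ((fun n => Nat.rec (f n.unpair.1)
      (fun y i => g (Nat.pair n.unpair.1 (Nat.pair y i))) n.unpair.2 : ℕ → ℕ) : ℕ →. ℕ) := by
  have : ((fun n => Nat.rec (f n.unpair.1)
      (fun y i => g (Nat.pair n.unpair.1 (Nat.pair y i))) n.unpair.2 : ℕ → ℕ) : ℕ →. ℕ) =
      Nat.unpaired fun a n => n.rec ((f : ℕ →. ℕ) a)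
        (fun y IH => IH.bind fun i => (g : ℕ →. ℕ) (Nat.pair a (Nat.pair y i))) := by
    funext n
    simp only [Nat.unpaired, PFun.coe_val]
    induction n.unpair.2 with
    | zero => rfl
    | succ k ih =>
      exact (Part.bind_some _ _).symm.trans (congrArg
        (fun p : Part ℕ => p.bind fun i =>
          Part.some (g (Nat.pair n.unpair.1 (Nat.pair k i)))) ih)
  exact this ▸ hf.prec hg

theorem computableIn_iff {f : ℕ → ℕ} : ComputableIn O f ↔ RecursiveIn O (f : ℕ →. ℕ) := by
  have : (fun n => Part.bind (Part.ofOption (decode (α := ℕ) n))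
      fun a => ((f : ℕ →. ℕ) a).map encode) = (f : ℕ →. ℕ) := by
    funext n
    simp
  rw [ComputableIn, PartrecIn, this]

theorem computableIn_pair {f : ℕ → ℕ} (hf : RecursiveIn O (f : ℕ →. ℕ)) :
    ComputableIn O fun p : ℕ × ℕ => f (Nat.pair p.1 p.2) := by
  have : (fun n => Part.bind (Part.ofOption (decode (α := ℕ × ℕ) n))
      fun a => (PFun.lift (fun p : ℕ × ℕ => f (Nat.pair p.1 p.2)) a).map encode) =
        (f : ℕ →. ℕ) := by
    funext n
    simp
  rwa [ComputableIn, PartrecIn, this]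

/-- The graph of `f`, coded as a set of natural numbers. -/
def graphSet (f : ℕ → ℕ) : Set ℕ := {n | f n.unpair.1 = n.unpair.2}

theorem recursiveIn_chi_graphSet (f : ℕ → ℕ) :
    RecursiveIn (chi (graphSet f)) (f : ℕ →. ℕ) := by
  have h : RecursiveIn (chi (graphSet f))
      ((fun n => 1 - chi (graphSet f) n : ℕ → ℕ) : ℕ →. ℕ) :=
    RecursiveIn.comp_total
      (.of_computable (f := fun n => 1 - n)
        (Primrec.nat_sub.comp (.const 1) .id).to_comp) .oracle
  have key : (fun a => Nat.rfind fun n => (fun m => decide (m = 0)) <$>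
      ((fun n => 1 - chi (graphSet f) n : ℕ → ℕ) : ℕ →. ℕ) (Nat.pair a n)) = (f : ℕ →. ℕ) := by
    funext a
    refine Part.eq_some_iff.2 (Nat.mem_rfind.2 ⟨?_, fun {m} hm => ?_⟩)
    · simp [chi, graphSet]
    · simp [chi, graphSet, hm.ne']
  exact key ▸ h.rfind

/-- `U` computes `g` from the initial segments of `f`. -/
structure IsUse (f : ℕ → ℕ) (g : ℕ →. ℕ) (U : List ℕ → ℕ →. ℕ) : Prop where
  partrec : Partrec₂ U
  mono : ∀ {l l' n v}, l <+: l' → v ∈ U l n → v ∈ U l' n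
  mem_iff : ∀ {n v}, v ∈ g n ↔ ∃ k, v ∈ U (seg f k) n

theorem seg_prefix (f : ℕ → ℕ) {k k' : ℕ} (h : k ≤ k') : seg f k <+: seg f k' := by
  obtain ⟨d, rfl⟩ := Nat.exists_eq_add_of_le h
  rw [seg_add]
  exact List.prefix_append _ _

theorem IsUse.of_partrec (f : ℕ → ℕ) {g : ℕ →. ℕ} (hg : Nat.Partrec g) :
    IsUse f g fun _ => g :=
  ⟨(Partrec.nat_iff.2 hg).comp .snd, fun _ h => h, by simp⟩

theorem exists_isUse {f : ℕ → ℕ} {g : ℕ →. ℕ} (hg : RecursiveIn (chi (graphSet f)) g) :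
    ∃ U, IsUse f g U := by
  induction hg with
  | zero => exact ⟨_, .of_partrec f .zero⟩
  | succ => exact ⟨_, .of_partrec f .succ⟩
  | left => exact ⟨_, .of_partrec f .left⟩
  | right => exact ⟨_, .of_partrec f .right⟩
  | oracle =>
    refine ⟨fun l n => (l[n.unpair.1]?.map fun m => if m = n.unpair.2 then 1 else 0 : Option ℕ),
      ?_, ?_, ?_⟩
    · have hu : Computable fun a : List ℕ × ℕ => a.2.unpair := Computable.unpair.comp .snd
      refine Computable.ofOption (Computable.option_map
        (Computable.list_getElem?.comp .fst (Computable.fst.comp hu)) ?_)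
      exact (Primrec.ite (Primrec.eq.comp .snd
        (Primrec.snd.comp (Primrec.unpair.comp (Primrec.snd.comp .fst))))
        (.const 1) (.const 0)).to_comp.to₂
    · rintro l l' n v ⟨t, rfl⟩ h
      simp only [Part.mem_ofOption, Option.mem_def, Option.map_eq_some_iff] at h ⊢
      obtain ⟨m, hm, h⟩ := h
      exact ⟨m, by rw [List.getElem?_append_left (List.getElem?_eq_some_iff.1 hm).1, hm], h⟩
    · intro n v
      simp only [PFun.coe_val, Part.mem_some_iff, Part.mem_ofOption, Option.mem_def,
        Option.map_eq_some_iff]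
      constructor
      · rintro rfl
        exact ⟨n.unpair.1 + 1, f n.unpair.1, by simp [seg], by unfold chi graphSet; congr 1⟩
      · rintro ⟨k, m, hm, rfl⟩
        obtain ⟨hk, hm⟩ := List.getElem?_eq_some_iff.1 hm
        have hm : f n.unpair.1 = m := by simpa [seg] using hm
        simp [chi, graphSet, hm]
  | @pair g h _ _ ihg ihh =>
    obtain ⟨U, hU⟩ := ihg
    obtain ⟨V, hV⟩ := ihh
    have key : ∀ (p q : Part ℕ) v, v ∈ Nat.pair <$> p <*> q ↔
        ∃ a ∈ p, ∃ b ∈ q, Nat.pair a b = v := by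
      intro p q v
      simp [Seq.seq]
    refine ⟨fun l n => Nat.pair <$> U l n <*> V l n, ?_, fun hl h => ?_, fun {n v} => ?_⟩
    · have hV' : Partrec fun a : (List ℕ × ℕ) × ℕ => V a.1.1 a.1.2 :=
        hV.partrec.comp (Computable.fst.comp .fst) (Computable.snd.comp .fst)
      refine (hU.partrec.bind (hV'.map (g := fun a b => Nat.pair a.2 b) ?_).to₂).of_eq
        fun a => ?_
      · exact (Primrec₂.natPair.comp (Primrec.snd.comp .fst) .snd).to_comp.to₂
      · simp [Seq.seq]
    · obtain ⟨a, ha, b, hb, rfl⟩ := (key _ _ _).1 h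
      exact (key _ _ _).2 ⟨a, hU.mono hl ha, b, hV.mono hl hb, rfl⟩
    · simp only [key]
      constructor
      · rintro ⟨a, ha, b, hb, rfl⟩
        obtain ⟨k, hk⟩ := hU.mem_iff.1 ha
        obtain ⟨k', hk'⟩ := hV.mem_iff.1 hb
        exact ⟨max k k', a, hU.mono (seg_prefix f (le_max_left _ _)) hk, b,
          hV.mono (seg_prefix f (le_max_right _ _)) hk', rfl⟩
      · rintro ⟨k, a, ha, b, hb, rfl⟩
        exact ⟨a, hU.mem_iff.2 ⟨k, ha⟩, b, hV.mem_iff.2 ⟨k, hb⟩, rfl⟩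
  | @comp g h _ _ ihg ihh =>
    obtain ⟨U, hU⟩ := ihg
    obtain ⟨V, hV⟩ := ihh
    refine ⟨fun l n => V l n >>= U l, ?_, fun hl h => ?_, fun {n v} => ?_⟩
    · exact hV.partrec.bind (hU.partrec.comp (Computable.fst.comp .fst) .snd)
    · obtain ⟨a, ha, hb⟩ := Part.mem_bind_iff.1 h
      exact Part.mem_bind_iff.2 ⟨a, hV.mono hl ha, hU.mono hl hb⟩
    · have key (p : Part ℕ) (q : ℕ → Part ℕ) : v ∈ p.bind q ↔ ∃ a ∈ p, v ∈ q a :=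
        Part.mem_bind_iff
      refine (key (h n) g).trans (Iff.trans ?_
        (exists_congr fun k => key (V (seg f k) n) (U (seg f k))).symm)
      constructor
      · rintro ⟨a, ha, hb⟩
        obtain ⟨k, hk⟩ := hV.mem_iff.1 ha
        obtain ⟨k', hk'⟩ := hU.mem_iff.1 hb
        exact ⟨max k k', a, hV.mono (seg_prefix f (le_max_left _ _)) hk,
          hU.mono (seg_prefix f (le_max_right _ _)) hk'⟩
      · rintro ⟨k, a, ha, hb⟩
        exact ⟨a, hV.mem_iff.2 ⟨k, ha⟩, hU.mem_iff.2 ⟨k, hb⟩⟩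
  | @prec g h _ _ ihg ihh =>
    obtain ⟨U, hU⟩ := ihg
    obtain ⟨V, hV⟩ := ihh
    let R (u w : ℕ →. ℕ) (a n : ℕ) : Part ℕ :=
      n.rec (u a) fun y IH => IH.bind fun i => w (Nat.pair a (Nat.pair y i))
    have hR (u w : ℕ →. ℕ) (a n v : ℕ) : v ∈ R u w a (n + 1) ↔
        ∃ i ∈ R u w a n, v ∈ w (Nat.pair a (Nat.pair n i)) := Part.mem_bind_iff
    have hmono : ∀ {l l' a n v}, l <+: l' → v ∈ R (U l) (V l) a n → v ∈ R (U l') (V l') a n := by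
      intro l l' a n v hl hv
      induction n generalizing v with
      | zero => exact hU.mono hl hv
      | succ n ih =>
        obtain ⟨i, hi, hv⟩ := (hR _ _ _ _ _).1 hv
        exact (hR _ _ _ _ _).2 ⟨i, ih hi, hV.mono hl hv⟩
    refine ⟨fun l => Nat.unpaired (R (U l) (V l)), ?_, fun hl hv => hmono hl hv,
      fun {n v} => ?_⟩
    · have hu : Computable fun a : List ℕ × ℕ => a.2.unpair := Computable.unpair.comp .snd
      refine Partrec.nat_rec (Computable.snd.comp hu)
        (hU.partrec.comp .fst (Computable.fst.comp hu))
        (h := fun a p => V a.1 (Nat.pair a.2.unpair.1 (Nat.pair p.1 p.2))) ?_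
      refine hV.partrec.comp (Computable.fst.comp .fst) ?_
      exact Primrec₂.natPair.to_comp.comp (Computable.fst.comp (hu.comp .fst))
        (Primrec₂.natPair.to_comp.comp (Computable.fst.comp .snd) (Computable.snd.comp .snd))
    · change v ∈ R g h n.unpair.1 n.unpair.2 ↔ ∃ k, v ∈ R _ _ n.unpair.1 n.unpair.2
      induction n.unpair.2 generalizing v with
      | zero => exact hU.mem_iff
      | succ m ih =>
        simp only [hR]
        constructor
        · rintro ⟨i, hi, hv⟩
          obtain ⟨k, hk⟩ := ih.1 hi
          obtain ⟨k', hk'⟩ := hV.mem_iff.1 hv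
          exact ⟨max k k', i, hmono (seg_prefix f (le_max_left _ _)) hk,
            hV.mono (seg_prefix f (le_max_right _ _)) hk'⟩
        · rintro ⟨k, i, hi, hv⟩
          exact ⟨i, ih.2 ⟨k, hi⟩, hV.mem_iff.2 ⟨k, hv⟩⟩
  | @rfind g _ ihg =>
    obtain ⟨U, hU⟩ := ihg
    have key (u : ℕ → Part ℕ) (a v : ℕ) :
        (v ∈ Nat.rfind fun n => (fun m => decide (m = 0)) <$> u (Nat.pair a n)) ↔
          0 ∈ u (Nat.pair a v) ∧ ∀ m < v, ∃ i ∈ u (Nat.pair a m), i ≠ 0 := by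
      refine Nat.mem_rfind.trans ?_
      simp
    refine ⟨fun l a => Nat.rfind fun n => (fun m => decide (m = 0)) <$> U l (Nat.pair a n),
      ?_, fun hl hv => ?_, fun {n v} => ?_⟩
    · refine Partrec.rfind ((hU.partrec.comp (Computable.fst.comp .fst)
        (Primrec₂.natPair.to_comp.comp (Computable.snd.comp .fst) .snd)).map ?_)
      exact (Primrec.eq.comp .snd (.const 0)).decide.to_comp.to₂
    · replace hv := (key _ _ _).1 hv
      exact (key _ _ _).2 ⟨hU.mono hl hv.1,
        fun m hm => (hv.2 m hm).imp fun i hi => ⟨hU.mono hl hi.1, hi.2⟩⟩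
    · refine (key g n v).trans (Iff.trans ?_ (exists_congr fun k => key (U (seg f k)) n v).symm)
      constructor
      · rintro ⟨h0, h⟩
        choose! i hi hi0 using h
        obtain ⟨k, hk⟩ := hU.mem_iff.1 h0
        have : ∀ m, ∃ k, m < v → i m ∈ U (seg f k) (Nat.pair n m) := fun m => by
          by_cases hm : m < v
          · exact (hU.mem_iff.1 (hi m hm)).imp fun _ h _ => h
          · exact ⟨0, fun h => absurd h hm⟩
        choose K hK using this
        refine ⟨k + (Finset.range v).sup K, hU.mono (seg_prefix f (by omega)) hk,
          fun m hm => ⟨i m, hU.mono (seg_prefix f ?_) (hK m hm), hi0 m hm⟩⟩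
        have := Finset.le_sup (f := K) (Finset.mem_range.2 hm)
        omega
      · rintro ⟨k, h0, h⟩
        exact ⟨hU.mem_iff.2 ⟨k, h0⟩,
          fun m hm => (h m hm).imp fun i hi => ⟨hU.mem_iff.2 ⟨k, hi.1⟩, hi.2⟩⟩

theorem exists_computes {f P : ℕ → ℕ} (h : ComputableIn (chi (graphSet f)) P) :
    ∃ c, Computes c f P := by
  obtain ⟨U, hU⟩ := exists_isUse (computableIn_iff.1 h)
  have hp : Nat.Partrec _ := hU.partrec
  obtain ⟨c, hc⟩ := Code.exists_code.1 hp
  have hc : ∀ l n, c.eval (Nat.pair (encode l) n) = U l n := by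
    intro l n
    have := congrFun hc (encode (l, n))
    simpa [Part.map_id'] using this
  refine ⟨c, fun n => ?_⟩
  simp only [hc]
  refine ⟨?_, fun k w hw => ?_⟩
  · obtain ⟨k₀, hk₀⟩ := hU.mem_iff.1 (show P n ∈ (P : ℕ →. ℕ) n by simp)
    exact ⟨k₀, fun k hk => hU.mono (seg_prefix f hk) hk₀⟩
  · simpa using hU.mem_iff.2 ⟨k, hw⟩

end Oracle

/-! ### Descending sequences from a dominating function -/

section Descending

open Encodable Denumerable

/-- `a` is a possible next term of a descending sequence of `L` whose last term, if there is one,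
is `s - 1`; `s = 0` stands for the empty sequence. -/
def LinOrd.Below (L : LinOrd) (s a : ℕ) : Prop := (s = 0 ∧ a ∈ L.dom) ∨ (s ≠ 0 ∧ L.lt a (s - 1))

/-- Some descending sequence of `L` starts below `s`. -/
def LinOrd.IllBelow (L : LinOrd) (s : ℕ) : Prop := ∃ f, IsDescSeq L f ∧ L.Below s (f 0)

/-- The order `linOrdOfCodes n` as seen after `m` steps of computation. -/
def linOrdStage (n m : ℕ) : LinOrd :=
  ⟨{a | (ofNat Code n.unpair.1).evaln m a = some 1},
   fun a b => (ofNat Code n.unpair.2).evaln m (Nat.pair a b) = some 1⟩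

theorem evaln_eq_one {c : Code} {m a : ℕ} (h : c.evaln m a = some 1) : c.eval a = Part.some 1 :=
  Part.eq_some_iff.2 (Nat.Partrec.Code.evaln_sound h)

theorem exists_evaln_eq_one {c : Code} {a : ℕ} (h : c.eval a = Part.some 1) :
    ∃ k, ∀ m ≥ k, c.evaln m a = some 1 := by
  obtain ⟨k, hk⟩ := Nat.Partrec.Code.evaln_complete.1 (Part.eq_some_iff.1 h)
  exact ⟨k, fun m hm => Nat.Partrec.Code.evaln_mono hm hk⟩

theorem LinOrd.Below.of_stage {n m s a : ℕ} (h : (linOrdStage n m).Below s a) :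
    (linOrdOfCodes n).Below s a :=
  h.imp (And.imp_right evaln_eq_one) (And.imp_right evaln_eq_one)

theorem exists_below_stage {n s a : ℕ} (h : (linOrdOfCodes n).Below s a) :
    ∃ k, ∀ m ≥ k, (linOrdStage n m).Below s a := by
  rcases h with ⟨hs, h⟩ | ⟨hs, h⟩
  · obtain ⟨k, hk⟩ := exists_evaln_eq_one h
    exact ⟨k, fun m hm => .inl ⟨hs, hk m hm⟩⟩
  · obtain ⟨k, hk⟩ := exists_evaln_eq_one h
    exact ⟨k, fun m hm => .inr ⟨hs, hk m hm⟩⟩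

instance (n m a : ℕ) : Decidable (a ∈ (linOrdStage n m).dom) :=
  inferInstanceAs (Decidable (Code.evaln m _ _ = some 1))

instance (n m a b : ℕ) : Decidable ((linOrdStage n m).lt a b) :=
  inferInstanceAs (Decidable (Code.evaln m _ _ = some 1))

instance (n m s a : ℕ) : Decidable ((linOrdStage n m).Below s a) :=
  inferInstanceAs (Decidable (_ ∨ _))

/-- The successor of the `a < j` found by scanning upwards for ever greater elements that are seen
to be below `s` by stage `m`, or `0` if there is none. -/
def largestBelow (n s m j : ℕ) : ℕ :=
  Nat.rec 0 (fun a best => if (linOrdStage n m).Below s a ∧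
    (best = 0 ∨ (linOrdStage n m).lt (best - 1) a) then a + 1 else best) j

theorem largestBelow_succ (n s m j : ℕ) :
    largestBelow n s m (j + 1) = if (linOrdStage n m).Below s j ∧ (largestBelow n s m j = 0 ∨
      (linOrdStage n m).lt (largestBelow n s m j - 1) j) then j + 1 else largestBelow n s m j :=
  rfl

theorem largestBelow_eq (n s m j : ℕ) : largestBelow n s m j = 0 ∨
    ∃ b < j, largestBelow n s m j = b + 1 ∧ (linOrdOfCodes n).Below s b := by
  induction j with
  | zero => exact .inl rfl
  | succ j ih =>
    rw [largestBelow_succ]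
    split_ifs with h
    · exact .inr ⟨j, j.lt_succ_self, rfl, h.1.of_stage⟩
    · exact ih.imp_right fun ⟨b, hb, h⟩ => ⟨b, hb.trans j.lt_succ_self, h⟩

theorem LinOrd.Below.mem_dom {L : LinOrd} (hL : L.IsValid) {s a : ℕ} (h : L.Below s a) :
    a ∈ L.dom :=
  h.elim And.right fun h => (hL.1 _ _ h.2).1

theorem exists_largestBelow {n s a : ℕ} (hn : (linOrdOfCodes n).IsValid)
    (ha : (linOrdOfCodes n).Below s a) : ∃ k, ∀ m ≥ k, ∃ b, largestBelow n s m m = b + 1 ∧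
      (linOrdOfCodes n).Below s b ∧ (b = a ∨ (linOrdOfCodes n).lt a b) := by
  obtain ⟨k₀, hk₀⟩ := exists_below_stage ha
  have hlt (b : ℕ) : ∃ k, (linOrdOfCodes n).lt b a → ∀ m ≥ k, (linOrdStage n m).lt b a := by
    by_cases h : (linOrdOfCodes n).lt b a
    · obtain ⟨k, hk⟩ := exists_evaln_eq_one h
      exact ⟨k, fun _ m hm => hk m hm⟩
    · exact ⟨0, fun h' => absurd h' h⟩
  choose K hK using hlt
  refine ⟨a + 1 + k₀ + (Finset.range a).sup K, fun m hm => ?_⟩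
  suffices h : ∀ j, a < j → ∃ b, largestBelow n s m j = b + 1 ∧
      (b = a ∨ (linOrdOfCodes n).lt a b) by
    obtain ⟨b, hb, hab⟩ := h m (by omega)
    obtain h0 | ⟨b', -, hb', hs⟩ := largestBelow_eq n s m m
    · omega
    · obtain rfl : b = b' := by omega
      exact ⟨b, hb, hs, hab⟩
  intro j hj
  induction j, hj using Nat.le_induction with
  | base =>
    rw [largestBelow_succ]
    split_ifs with h
    · exact ⟨a, rfl, .inl rfl⟩
    · obtain h0 | ⟨b, hba, hb, hs⟩ := largestBelow_eq n s m a
      · exact absurd ⟨hk₀ m (by omega), .inl h0⟩ h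
      · refine ⟨b, hb, .inr ?_⟩
        rcases hn.2.2.2 a (ha.mem_dom hn) b (hs.mem_dom hn) with rfl | h' | h'
        · exact absurd hba (lt_irrefl _)
        · exact h'
        · refine absurd ⟨hk₀ m (by omega), .inr ?_⟩ h
          have := Finset.le_sup (f := K) (Finset.mem_range.2 hba)
          rw [hb]
          exact hK b h' m (by omega)
  | succ j hj ih =>
    obtain ⟨b, hb, hab⟩ := ih
    rw [largestBelow_succ]
    split_ifs with h
    · refine ⟨j, rfl, .inr ?_⟩
      have hbj : (linOrdOfCodes n).lt b j := by
        rcases h.2 with h | h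
        · omega
        · rw [hb] at h
          exact evaln_eq_one h
      rcases hab with rfl | hab
      · exact hbj
      · exact hn.2.2.1 _ _ _ hab hbj
    · exact ⟨b, hb, hab⟩

theorem LinOrd.IllBelow.exists_next {n s : ℕ} (hn : (linOrdOfCodes n).IsValid)
    (h : (linOrdOfCodes n).IllBelow s) : ∃ k, ∀ m ≥ k, ∃ b, largestBelow n s m m = b + 1 ∧
      (linOrdOfCodes n).Below s b ∧ (linOrdOfCodes n).IllBelow (b + 1) := by
  obtain ⟨f, hf, hs⟩ := h
  obtain ⟨k, hk⟩ := exists_largestBelow hn hs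
  refine ⟨k, fun m hm => ?_⟩
  obtain ⟨b, hb, hsb, hab⟩ := hk m hm
  refine ⟨b, hb, hsb, fun i => f (i + 1), fun i => hf (i + 1), .inr ⟨b.succ_ne_zero, ?_⟩⟩
  rcases hab with rfl | hab
  · exact (hf 0).2
  · exact hn.2.2.1 _ _ _ (hf 0).2 hab

theorem primrecPred_evaln_eq_one {α : Type} [Primcodable α] {e m x : α → ℕ} (he : Primrec e)
    (hm : Primrec m) (hx : Primrec x) :
    PrimrecPred fun p => (ofNat Code (e p)).evaln (m p) (x p) = some 1 :=
  Primrec.eq.comp (Nat.Partrec.Code.primrec_evaln.comp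
    ((hm.pair ((Primrec.ofNat Code).comp he)).pair hx)) (.const (some 1))

theorem primrecPred_linOrdStage_lt {α : Type} [Primcodable α] {n m x y : α → ℕ}
    (hn : Primrec n) (hm : Primrec m) (hx : Primrec x) (hy : Primrec y) :
    PrimrecPred fun p => (linOrdStage (n p) (m p)).lt (x p) (y p) :=
  primrecPred_evaln_eq_one (.comp .snd (Primrec.unpair.comp hn)) hm (Primrec₂.natPair.comp hx hy)

theorem primrecPred_linOrdStage_below {α : Type} [Primcodable α] {n m s x : α → ℕ}
    (hn : Primrec n) (hm : Primrec m) (hs : Primrec s) (hx : Primrec x) :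
    PrimrecPred fun p => (linOrdStage (n p) (m p)).Below (s p) (x p) := by
  have h0 : PrimrecPred fun p => s p = 0 := Primrec.eq.comp hs (.const 0)
  exact (h0.and (primrecPred_evaln_eq_one (.comp .fst (Primrec.unpair.comp hn)) hm hx)).or
    (h0.not.and (primrecPred_linOrdStage_lt hn hm hx (Primrec.pred.comp hs)))

theorem primrec_largestBelow {α : Type} [Primcodable α] {n s m j : α → ℕ}
    (hn : Primrec n) (hs : Primrec s) (hm : Primrec m) (hj : Primrec j) :
    Primrec fun p => largestBelow (n p) (s p) (m p) (j p) := by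
  have ha : Primrec fun q : α × ℕ × ℕ => q.2.1 := .comp .fst .snd
  have hb : Primrec fun q : α × ℕ × ℕ => q.2.2 := .comp .snd .snd
  have hn' := hn.comp (Primrec.fst (α := α) (β := ℕ × ℕ))
  have hm' := hm.comp (Primrec.fst (α := α) (β := ℕ × ℕ))
  have hs' := hs.comp (Primrec.fst (α := α) (β := ℕ × ℕ))
  refine Primrec.nat_rec' hj (.const 0) (Primrec.ite (PrimrecPred.and
    (primrecPred_linOrdStage_below hn' hm' hs' ha) (PrimrecPred.or (Primrec.eq.comp hb (.const 0))
      (primrecPred_linOrdStage_lt hn' hm' (Primrec.pred.comp hb) ha)))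
        (Primrec.succ.comp ha) hb).to₂

/-- The greedy descending sequence of `linOrdOfCodes n` found by searching, after a partial
sequence coded by `s`, for `f (Nat.pair n s)` steps. -/
def greedySeq (f : ℕ → ℕ) (n k : ℕ) : ℕ :=
  Nat.rec 0 (fun _ s => largestBelow n s (f (Nat.pair n s)) (f (Nat.pair n s))) k

theorem computableIn_greedySeq {O f : ℕ → ℕ} (hf : RecursiveIn O (f : ℕ →. ℕ)) :
    ComputableIn O fun p : ℕ × ℕ => greedySeq f p.1 (p.2 + 1) - 1 := by
  have hu : Primrec fun q : ℕ => q.unpair.1 := .comp .fst .unpair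
  have hv : Primrec fun q : ℕ => q.unpair.2 := .comp .snd .unpair
  have hstep := RecursiveIn.comp_total (O := O)
    (.of_computable (primrec_largestBelow (hu.comp hu) (hv.comp hu) hv hv).to_comp)
    (RecursiveIn.pair_total (.of_computable Computable.id) hf)
  have hrec := (RecursiveIn.of_computable (O := O) (Computable.const 0)).prec_total
    (hstep.comp_total (.of_computable
      (Primrec₂.natPair.comp hu (hv.comp hv)).to_comp))
  have := (RecursiveIn.of_computable (O := O) Primrec.pred.to_comp).comp_total
    (hrec.comp_total (.of_computable (Primrec₂.natPair.comp hu (Primrec.succ.comp hv)).to_comp))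
  refine Eq.mp (congrArg _ (funext fun p => ?_)) (computableIn_pair this)
  simp [greedySeq]

theorem exists_dominating_loqHighForDS :
    ∃ F : ℕ → ℕ, ∀ f, (∀ n, F n ≤ f n) → LoqHighForDS (graphSet f) := by
  have h (p : ℕ) : ∃ k, (linOrdOfCodes p.unpair.1).IsValid →
      (linOrdOfCodes p.unpair.1).IllBelow p.unpair.2 → ∀ m ≥ k, ∃ b,
        largestBelow p.unpair.1 p.unpair.2 m m = b + 1 ∧
        (linOrdOfCodes p.unpair.1).Below p.unpair.2 b ∧
        (linOrdOfCodes p.unpair.1).IllBelow (b + 1) := by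
    by_cases h : (linOrdOfCodes p.unpair.1).IsValid ∧
      (linOrdOfCodes p.unpair.1).IllBelow p.unpair.2
    · exact (h.2.exists_next h.1).imp fun k hk _ _ => hk
    · exact ⟨0, fun h₁ h₂ => absurd ⟨h₁, h₂⟩ h⟩
  choose F hF using h
  refine ⟨F, fun f hf => ⟨_, computableIn_greedySeq (recursiveIn_chi_graphSet f), fun n hn => ?_⟩⟩
  by_cases hd : DecidesLinOrd n
  swap
  · obtain ⟨g, hg⟩ := hn
    have := (hg 0).1
    simp [linOrdAt, hd] at this
  have hL : linOrdAt n = linOrdOfCodes n := if_pos hd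
  rw [hL] at hn ⊢
  have hv := hd.2.2
  have step (s : ℕ) (hs : (linOrdOfCodes n).IllBelow s) := by
    have := hF (Nat.pair n s)
    simp only [Nat.unpair_pair] at this
    exact this hv hs _ (hf _)
  have hill (k : ℕ) : (linOrdOfCodes n).IllBelow (greedySeq f n k) := by
    induction k with
    | zero => exact hn.imp fun g hg => ⟨hg, .inl ⟨rfl, (hg 0).1⟩⟩
    | succ k ih =>
      obtain ⟨b, hb, -, h⟩ := step _ ih
      exact (show greedySeq f n (k + 1) = b + 1 from hb) ▸ h
  intro k
  obtain ⟨b, hb, hsb, hib⟩ := step _ (hill k)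
  obtain ⟨b', hb', hsb', -⟩ := step _ (hill (k + 1))
  replace hb : greedySeq f n (k + 1) = b + 1 := hb
  replace hb' : greedySeq f n (k + 1 + 1) = b' + 1 := hb'
  simp only [hb, hb', Nat.add_sub_cancel]
  refine ⟨hsb.mem_dom hv, ?_⟩
  rw [hb] at hsb'
  exact hsb'.elim (fun h => absurd h.1 b.succ_ne_zero) And.right

end Descending

/-- There is a set `X` that is loquaciously high for descending sequences
but not high for paths: some ill-founded computable tree has no `X`-computable path. -/
theorem exists_loqHighForDS_not_highForPaths :
    ∃ X : Set ℕ, LoqHighForDS X ∧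
      ∃ T : Set (List ℕ), ComputableTree T ∧ IllFounded T ∧
        ¬ ∃ f : ℕ → ℕ, ComputableIn (chi X) f ∧ IsPath T f := by
  obtain ⟨F, hF⟩ := exists_dominating_loqHighForDS
  obtain ⟨f, hf, hnc⟩ := exists_dominating_not_computes F
  refine ⟨graphSet f, hF f hf, prefixTree Respects,
    computableTree_prefixTree primrecPred_respects, illFounded_respects, ?_⟩
  rintro ⟨P, hP, hpath⟩
  obtain ⟨c, hc⟩ := exists_computes hP
  exact hnc c P hpath hc

end CFT
end

section
/- If X ⊆ ℕ is uniformly high for paths and WF = {e : T_e is well-founded} is c.e. in X, then X is loquaciously high for paths. -/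
namespace CFT

open Nat.Partrec (Code)

theorem some_bind_pfun (f : ℕ →. ℕ) (a : ℕ) : (Part.some a >>= f) = f a := Part.bind_some _ _

theorem mem_bind_pfun {p : Part ℕ} {f : ℕ →. ℕ} {y : ℕ} :
    y ∈ (p >>= f) ↔ ∃ a ∈ p, y ∈ f a := Part.mem_bind_iff

theorem mem_rfind_pair {f : ℕ →. ℕ} {a m : ℕ} :
    m ∈ (Nat.rfind fun n => (fun v => decide (v = 0)) <$> f (Nat.pair a n)) ↔
      0 ∈ f (Nat.pair a m) ∧ ∀ j < m, ∃ v, v ≠ 0 ∧ v ∈ f (Nat.pair a j) := by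
  refine Nat.mem_rfind.trans (and_congr ?_ (forall₂_congr fun j _ => ?_))
  · refine (Part.mem_map_iff _).trans ?_
    simp
  · refine (Part.mem_map_iff _).trans ?_
    simp [and_comm]

/-- The initial segment `[O 0, …, O (k - 1)]` of an oracle. -/
def oraclePrefix (O : ℕ → ℕ) (k : ℕ) : List ℕ := (List.range k).map O

theorem oraclePrefix_succ (O : ℕ → ℕ) (k : ℕ) :
    oraclePrefix O (k + 1) = oraclePrefix O k ++ [O k] := by
  simp [oraclePrefix, List.range_succ]

namespace RecursiveIn

variable {O : ℕ → ℕ}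

theorem of_partrec_s8 {f : ℕ →. ℕ} (hf : Nat.Partrec f) : RecursiveIn O f := by
  induction hf with
  | zero => exact .zero
  | succ => exact .succ
  | left => exact .left
  | right => exact .right
  | pair _ _ ihf ihg => exact .pair ihf ihg
  | comp _ _ ihf ihg => exact .comp ihf ihg
  | prec _ _ ihf ihg => exact .prec ihf ihg
  | rfind _ ihf => exact .rfind ihf

theorem of_primrec {f : ℕ → ℕ} (hf : Primrec f) : RecursiveIn O (f : ℕ →. ℕ) :=
  of_partrec_s8 (Partrec.nat_iff.1 hf.to_comp)

theorem comp_total_s8 {f g : ℕ → ℕ} (hf : RecursiveIn O (f : ℕ →. ℕ))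
    (hg : RecursiveIn O (g : ℕ →. ℕ)) : RecursiveIn O ((fun n => f (g n) : ℕ → ℕ) : ℕ →. ℕ) := by
  have h := comp hf hg
  have e : (fun n => (g : ℕ →. ℕ) n >>= (f : ℕ →. ℕ)) = ((fun n => f (g n) : ℕ → ℕ) : ℕ →. ℕ) := by
    funext n; exact some_bind_pfun _ _
  rwa [e] at h

theorem pair_total_s8 {f g : ℕ → ℕ} (hf : RecursiveIn O (f : ℕ →. ℕ))
    (hg : RecursiveIn O (g : ℕ →. ℕ)) :
    RecursiveIn O ((fun n => Nat.pair (f n) (g n) : ℕ → ℕ) : ℕ →. ℕ) := by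
  have h := pair hf hg
  have e : (fun n => Nat.pair <$> (f : ℕ →. ℕ) n <*> (g : ℕ →. ℕ) n) =
      ((fun n => Nat.pair (f n) (g n) : ℕ → ℕ) : ℕ →. ℕ) := by
    funext n; simp [Seq.seq]
  rwa [e] at h

theorem encode_oraclePrefix :
    RecursiveIn O ((fun k => Encodable.encode (oraclePrefix O k) : ℕ → ℕ) : ℕ →. ℕ) := by
  have happ : Primrec fun p : ℕ =>
      Encodable.encode (Denumerable.ofNat (List ℕ) p.unpair.1 ++ [p.unpair.2]) :=
    Primrec.encode.comp (Primrec.list_append.comp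
      ((Primrec.ofNat _).comp (Primrec.fst.comp Primrec.unpair))
      (Primrec.list_cons.comp (Primrec.snd.comp Primrec.unpair) (Primrec.const [])))
  have hstep := comp_total_s8 (O := O) (of_primrec happ)
    (pair_total_s8 (comp_total_s8 right right) (comp_total_s8 oracle (comp_total_s8 left right)))
  have hbase := of_primrec (O := O) (Primrec.const (Encodable.encode ([] : List ℕ)))
  have hrec := comp (prec hbase hstep)
    (of_primrec (O := O) (Primrec₂.natPair.comp (Primrec.const 0) Primrec.id))
  refine cast (congrArg _ (funext fun k => ?_)) hrec
  refine (some_bind_pfun _ _).trans ?_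
  simp only [PFun.coe_val, Part.bind_eq_bind, Nat.unpaired, Nat.unpair_pair, id]
  induction k with
  | zero => rfl
  | succ k ih =>
    refine (congrArg (fun p => Part.bind p _) ih).trans ?_
    simp [oraclePrefix_succ]

/-- Every function recursive in `O` has a primitive recursive monotone approximation by the
initial segments of `O`. -/
theorem exists_approx {f : ℕ →. ℕ} (hf : RecursiveIn O f) :
    ∃ Φ : List ℕ → ℕ → Option ℕ, Primrec₂ Φ ∧
      (∀ n y, Monotone fun k => y ∈ Φ (oraclePrefix O k) n) ∧
      ∀ n y, y ∈ f n ↔ ∃ k, y ∈ Φ (oraclePrefix O k) n := by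
  induction hf with
  | zero =>
    refine ⟨fun _ _ => some 0, Primrec.const _, fun _ _ _ _ _ h => h, fun n y => ?_⟩
    simp [pure, PFun.pure, eq_comm]
  | succ =>
    refine ⟨fun _ n => some n.succ, Primrec.option_some.comp (Primrec.succ.comp Primrec.snd),
      fun _ _ _ _ _ h => h, fun n y => ?_⟩
    simp [eq_comm]
  | left =>
    refine ⟨fun _ n => some n.unpair.1,
      Primrec.option_some.comp (Primrec.fst.comp (Primrec.unpair.comp Primrec.snd)),
      fun _ _ _ _ _ h => h, fun n y => ?_⟩
    simp [eq_comm]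
  | right =>
    refine ⟨fun _ n => some n.unpair.2,
      Primrec.option_some.comp (Primrec.snd.comp (Primrec.unpair.comp Primrec.snd)),
      fun _ _ _ _ _ h => h, fun n y => ?_⟩
    simp [eq_comm]
  | oracle =>
    refine ⟨fun σ n => σ[n]?, Primrec.list_getElem?, fun n y j k hjk => ?_, fun n y => ?_⟩
    · simp only [oraclePrefix, le_Prop_eq, Option.mem_def, List.getElem?_eq_some_iff]
      rintro ⟨h, rfl⟩
      simp at h
      exact ⟨by simp; omega, by simp⟩
    · simp only [oraclePrefix, Option.mem_def, List.getElem?_eq_some_iff]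
      constructor
      · intro h
        exact ⟨n + 1, by simp, by simpa [eq_comm] using h⟩
      · rintro ⟨k, h, rfl⟩
        simp
  | @pair f g _ _ ihf ihg =>
    obtain ⟨Φ, hΦ, mΦ, cΦ⟩ := ihf
    obtain ⟨Ψ, hΨ, mΨ, cΨ⟩ := ihg
    refine ⟨fun σ n => (Φ σ n).bind fun a => (Ψ σ n).map (Nat.pair a), ?_, ?_, ?_⟩
    · exact Primrec.option_bind hΦ (Primrec.option_map (hΨ.comp (Primrec.fst.comp Primrec.fst)
        (Primrec.snd.comp Primrec.fst)) (Primrec₂.natPair.comp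
          (Primrec.snd.comp Primrec.fst) Primrec.snd))
    · intro n y j k hjk
      simp only [le_Prop_eq, Option.mem_def, Option.bind_eq_some_iff, Option.map_eq_some_iff]
      rintro ⟨a, ha, b, hb, rfl⟩
      exact ⟨a, mΦ n a hjk ha, b, mΨ n b hjk hb, rfl⟩
    · intro n y
      simp only [Seq.seq, Part.map_eq_map, Part.bind_map, Part.mem_bind_iff, Part.mem_map_iff,
        Option.mem_def, Option.bind_eq_some_iff, Option.map_eq_some_iff]
      constructor
      · rintro ⟨a, ha, b, hb, rfl⟩
        obtain ⟨j, hj⟩ := (cΦ n a).1 ha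
        obtain ⟨k, hk⟩ := (cΨ n b).1 hb
        exact ⟨max j k, a, mΦ n a (le_max_left j k) hj, b, mΨ n b (le_max_right j k) hk, rfl⟩
      · rintro ⟨k, a, ha, b, hb, rfl⟩
        exact ⟨a, (cΦ n a).2 ⟨k, ha⟩, b, (cΨ n b).2 ⟨k, hb⟩, rfl⟩
  | @comp f g _ _ ihf ihg =>
    obtain ⟨Φ, hΦ, mΦ, cΦ⟩ := ihf
    obtain ⟨Ψ, hΨ, mΨ, cΨ⟩ := ihg
    refine ⟨fun σ n => (Ψ σ n).bind (Φ σ), ?_, ?_, ?_⟩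
    · exact Primrec.option_bind hΨ (hΦ.comp (Primrec.fst.comp Primrec.fst) Primrec.snd)
    · intro n y j k hjk
      simp only [le_Prop_eq, Option.mem_def, Option.bind_eq_some_iff]
      rintro ⟨a, ha, hy⟩
      exact ⟨a, mΨ n a hjk ha, mΦ a y hjk hy⟩
    · intro n y
      simp only [mem_bind_pfun, Option.mem_def, Option.bind_eq_some_iff]
      constructor
      · rintro ⟨a, ha, hy⟩
        obtain ⟨j, hj⟩ := (cΨ n a).1 ha
        obtain ⟨k, hk⟩ := (cΦ a y).1 hy
        exact ⟨max j k, a, mΨ n a (le_max_left j k) hj, mΦ a y (le_max_right j k) hk⟩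
      · rintro ⟨k, a, ha, hy⟩
        exact ⟨a, (cΨ n a).2 ⟨k, ha⟩, (cΦ a y).2 ⟨k, hy⟩⟩
  | @prec f g _ _ ihf ihg =>
    obtain ⟨Φ, hΦ, mΦ, cΦ⟩ := ihf
    obtain ⟨Ψ, hΨ, mΨ, cΨ⟩ := ihg
    let R : List ℕ → ℕ → ℕ → Option ℕ := fun σ a n =>
      n.rec (Φ σ a) fun m o => o.bind fun i => Ψ σ (Nat.pair a (Nat.pair m i))
    have mR : ∀ a n y, Monotone fun k => y ∈ R (oraclePrefix O k) a n := by
      intro a n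
      induction n with
      | zero => exact mΦ a
      | succ n ih =>
        intro y j k hjk
        simp only [R, le_Prop_eq, Option.mem_def, Option.bind_eq_some_iff]
        rintro ⟨i, hi, hy⟩
        exact ⟨i, ih i hjk hi, mΨ _ y hjk hy⟩
    refine ⟨fun σ p => R σ p.unpair.1 p.unpair.2, ?_, fun p y => mR _ _ y, fun p => ?_⟩
    · have hfst : Primrec fun q : List ℕ × ℕ => q.2.unpair.1 :=
        Primrec.fst.comp (Primrec.unpair.comp Primrec.snd)
      have hsnd : Primrec fun q : List ℕ × ℕ => q.2.unpair.2 :=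
        Primrec.snd.comp (Primrec.unpair.comp Primrec.snd)
      have hstep : Primrec₂ fun (q : List ℕ × ℕ) (r : ℕ × Option ℕ) =>
          r.2.bind fun i => Ψ q.1 (Nat.pair q.2.unpair.1 (Nat.pair r.1 i)) :=
        Primrec.option_bind (Primrec.snd.comp Primrec.snd)
          (hΨ.comp (Primrec.fst.comp (Primrec.fst.comp Primrec.fst))
            (Primrec₂.natPair.comp (hfst.comp (Primrec.fst.comp Primrec.fst))
              (Primrec₂.natPair.comp (Primrec.fst.comp (Primrec.snd.comp Primrec.fst))
                Primrec.snd)))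
      exact Primrec.nat_rec' hsnd (hΦ.comp Primrec.fst hfst) hstep
    · simp only [Nat.unpaired]
      generalize p.unpair.1 = a
      generalize p.unpair.2 = n
      induction n with
      | zero => exact cΦ a
      | succ n ih =>
        intro y
        simp only [R, Part.bind_eq_bind, Part.mem_bind_iff, Option.mem_def,
          Option.bind_eq_some_iff]
        constructor
        · rintro ⟨i, hi, hy⟩
          obtain ⟨j, hj⟩ := (ih i).1 hi
          obtain ⟨k, hk⟩ := (cΨ _ y).1 hy
          exact ⟨max j k, i, mR a n i (le_max_left j k) hj, mΨ _ y (le_max_right j k) hk⟩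
        · rintro ⟨k, i, hi, hy⟩
          exact ⟨i, (ih i).2 ⟨k, hi⟩, (cΨ _ y).2 ⟨k, hy⟩⟩
  | @rfind f _ ihf =>
    obtain ⟨Φ, hΦ, mΦ, cΦ⟩ := ihf
    let P : List ℕ → ℕ → ℕ → Bool := fun σ a m =>
      decide ((Φ σ (Nat.pair a m)).getD 0 = 0)
    let idx : List ℕ → ℕ → ℕ := fun σ a => (List.range σ.length).findIdx (P σ a)
    let S : List ℕ → ℕ → Option ℕ := fun σ a =>
      if Φ σ (Nat.pair a (idx σ a)) = some 0 then some (idx σ a) else none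
    have hS : ∀ σ a m, m ∈ S σ a ↔ m ≤ σ.length ∧ 0 ∈ Φ σ (Nat.pair a m) ∧
        ∀ j < m, ∃ v, v ≠ 0 ∧ v ∈ Φ σ (Nat.pair a j) := by
      intro σ a m
      have hP : ∀ j, P σ a j = false ↔ ∃ v, v ≠ 0 ∧ v ∈ Φ σ (Nat.pair a j) := by
        intro j
        simp only [P]
        cases h : Φ σ (Nat.pair a j) <;> simp [eq_comm]
      have hle : idx σ a ≤ σ.length := by
        simpa [idx] using List.findIdx_le_length (p := P σ a) (xs := List.range σ.length)
      have hlt : ∀ j < idx σ a, P σ a j = false := by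
        intro j hj
        have := List.not_of_lt_findIdx hj
        simpa using this
      constructor
      · intro h
        simp only [S] at h
        split_ifs at h with h0
        · obtain rfl : idx σ a = m := by simpa using h
          exact ⟨hle, h0, fun j hj => (hP j).1 (hlt j hj)⟩
        · simp at h
      · rintro ⟨hm, h0, hj⟩
        have hPm : P σ a m = true := by
          have h0' : Φ σ (Nat.pair a m) = some 0 := h0
          simp [P, h0']
        have e : idx σ a = m := by
          rcases lt_trichotomy (idx σ a) m with hlt' | he | hgt
          · have hf := (hP _).2 (hj _ hlt')
            have hlen : idx σ a < (List.range σ.length).length := by simp; omega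
            have := List.findIdx_getElem (w := hlen)
            simp only [List.getElem_range] at this
            rw [show List.findIdx (P σ a) (List.range σ.length) = idx σ a from rfl, hf] at this
            cases this
          · exact he
          · rw [hlt m hgt] at hPm
            cases hPm
        have h0' : Φ σ (Nat.pair a m) = some 0 := h0
        simp [S, e, h0']
    have hmono : ∀ a m, Monotone fun k => m ∈ S (oraclePrefix O k) a := by
      intro a m j k hjk
      simp only [hS, le_Prop_eq]
      rintro ⟨hm, h0, hj⟩
      refine ⟨hm.trans (by simpa [oraclePrefix] using hjk), mΦ _ _ hjk h0, fun i hi => ?_⟩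
      obtain ⟨v, hv, hvi⟩ := hj i hi
      exact ⟨v, hv, mΦ _ _ hjk hvi⟩
    refine ⟨S, ?_, hmono, fun a m => ?_⟩
    · have hPr : Primrec₂ fun (q : List ℕ × ℕ) (m : ℕ) => P q.1 q.2 m := by
        refine PrimrecPred.decide (Primrec.eq.comp
          (Primrec.option_getD.comp (hΦ.comp (Primrec.fst.comp Primrec.fst)
            (Primrec₂.natPair.comp (Primrec.snd.comp Primrec.fst) Primrec.snd))
            (Primrec.const 0)) (Primrec.const 0))
      have hidx : Primrec fun q : List ℕ × ℕ => idx q.1 q.2 :=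
        Primrec.list_findIdx (Primrec.list_range.comp (Primrec.list_length.comp Primrec.fst)) hPr
      exact Primrec.ite (Primrec.eq.comp (hΦ.comp Primrec.fst
        (Primrec₂.natPair.comp Primrec.snd hidx)) (Primrec.const (some 0)))
        (Primrec.option_some.comp hidx) (Primrec.const none)
    · simp only [mem_rfind_pair, hS]
      constructor
      · rintro ⟨hz, hlt⟩
        obtain ⟨k₀, hk₀⟩ := (cΦ _ _).1 hz
        have hex : ∀ j, ∃ k, j < m → ∃ v, v ≠ 0 ∧ v ∈ Φ (oraclePrefix O k) (Nat.pair a j) := by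
          intro j
          by_cases hj : j < m
          · obtain ⟨v, hv0, hv⟩ := hlt j hj
            obtain ⟨k, hk⟩ := (cΦ _ _).1 hv
            exact ⟨k, fun _ => ⟨v, hv0, hk⟩⟩
          · exact ⟨0, fun h => absurd h hj⟩
        choose κ hκ using hex
        refine ⟨max (max m k₀) ((Finset.range m).sup κ), ?_, mΦ _ _ (by simp) hk₀,
          fun j hj => ?_⟩
        · simp [oraclePrefix]
        · obtain ⟨v, hv, hvj⟩ := hκ j hj
          exact ⟨v, hv, mΦ _ _ (le_max_of_le_right
            (Finset.le_sup (f := κ) (Finset.mem_range.2 hj))) hvj⟩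
      · rintro ⟨k, -, h0, hj⟩
        refine ⟨(cΦ _ _).2 ⟨k, h0⟩, fun j hjm => ?_⟩
        obtain ⟨v, hv, hvj⟩ := hj j hjm
        exact ⟨v, hv, (cΦ _ _).2 ⟨k, hvj⟩⟩

/-- Unbounded search along the initial segments of the oracle. -/
theorem exists_search {Θ : List ℕ → ℕ → Option ℕ} (hΘ : Primrec₂ Θ)
    (h : ∀ a, ∃ k, (Θ (oraclePrefix O k) a).isSome) :
    ∃ G : ℕ → ℕ, RecursiveIn O (G : ℕ →. ℕ) ∧ ∀ a, ∃ k, G a ∈ Θ (oraclePrefix O k) a := by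
  classical
  have hσ : Primrec fun p : ℕ => Denumerable.ofNat (List ℕ) p.unpair.2 :=
    (Primrec.ofNat _).comp (Primrec.snd.comp Primrec.unpair)
  have hval : Primrec fun p : ℕ => Θ (Denumerable.ofNat (List ℕ) p.unpair.2) p.unpair.1 :=
    hΘ.comp hσ (Primrec.fst.comp Primrec.unpair)
  have hseg := pair_total_s8 (left (O := O)) (comp_total_s8 encode_oraclePrefix right)
  have htest := comp_total_s8 (of_primrec (O := O)
    (Primrec.cond (Primrec.option_isSome.comp hval) (Primrec.const 0) (Primrec.const 1))) hseg
  have hout := comp_total_s8 (of_primrec (O := O)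
    (Primrec.option_getD.comp hval (Primrec.const 0))) hseg
  have hG := comp hout (pair (of_primrec (O := O) Primrec.id) (rfind htest))
  refine ⟨fun a => (Θ (oraclePrefix O (Nat.find (h a))) a).getD 0, ?_, fun a => ?_⟩
  · refine cast (congrArg _ (funext fun a => ?_)) hG
    have hfind : (Nat.rfind fun n => (fun m => decide (m = 0)) <$>
        ((fun p : ℕ => bif (Θ (oraclePrefix O p.unpair.2) p.unpair.1).isSome then 0 else 1 :
          ℕ → ℕ) : ℕ →. ℕ) (Nat.pair a n)) = Part.some (Nat.find (h a)) := by
      refine Part.eq_some_iff.2 (mem_rfind_pair.2 ⟨?_, fun m hm => ⟨1, one_ne_zero, ?_⟩⟩)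
      · simp [Nat.find_spec (h a)]
      · have := Nat.find_min (h a) hm
        simp only [Bool.not_eq_true] at this
        simp [this]
    simp only [Nat.unpair_pair, Denumerable.ofNat_encode]
    rw [hfind]
    simp only [Seq.seq, Part.map_eq_map, PFun.coe_val, id, Part.map_some, Part.bind_some]
    rw [some_bind_pfun]
    simp
  · obtain ⟨v, hv⟩ := Option.isSome_iff_exists.1 (Nat.find_spec (h a))
    exact ⟨Nat.find (h a), by simp [hv]⟩

/-- Dovetailing: if at each argument one of two functions recursive in `O` is defined, then some
total function recursive in `O` takes at each argument a value of one of them. -/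
theorem exists_merge {f g : ℕ →. ℕ} (hf : RecursiveIn O f) (hg : RecursiveIn O g)
    (h : ∀ a, (f a).Dom ∨ (g a).Dom) :
    ∃ G : ℕ → ℕ, RecursiveIn O (G : ℕ →. ℕ) ∧ ∀ a, G a ∈ f a ∨ G a ∈ g a := by
  obtain ⟨Φ, hΦ, -, cΦ⟩ := exists_approx hf
  obtain ⟨Ψ, hΨ, -, cΨ⟩ := exists_approx hg
  obtain ⟨G, hG, hmem⟩ := exists_search (O := O) (Θ := fun σ a => (Φ σ a <|> Ψ σ a))
    (Primrec.option_orElse.comp hΦ hΨ) (by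
      intro a
      rcases h a with ha | ha
      · obtain ⟨k, hk⟩ := (cΦ a _).1 (Part.get_mem ha)
        exact ⟨k, by simp [Option.mem_def.1 hk]⟩
      · obtain ⟨k, hk⟩ := (cΨ a _).1 (Part.get_mem ha)
        exact ⟨k, by simp [Option.mem_def.1 hk]⟩)
  refine ⟨G, hG, fun a => ?_⟩
  obtain ⟨k, hk⟩ := hmem a
  rw [Option.mem_def, Option.orElse_eq_some] at hk
  rcases hk with hk | ⟨-, hk⟩
  · exact Or.inl ((cΦ a _).2 ⟨k, hk⟩)
  · exact Or.inr ((cΨ a _).2 ⟨k, hk⟩)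

end RecursiveIn

/-- If `X` is uniformly high for paths and `WF` is c.e. in `X`, then
`X` is loquaciously high for paths. -/
theorem unifHighForPaths_enum_WF_loqHighForPaths (X : Set ℕ)
    (h₁ : UnifHighForPaths X) (h₂ : CEIn X WF) : LoqHighForPaths X := by
  obtain ⟨F, hF, hpath⟩ := h₁
  obtain ⟨w, hw, hWF⟩ := h₂
  have hF' : RecursiveIn (chi X) fun p => F p.unpair := by
    refine cast (congrArg _ (funext fun p => ?_)) hF
    simp [Part.map_id']
  have hw' : RecursiveIn (chi X) w := by
    refine cast (congrArg _ (funext fun p => ?_)) hw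
    simp [Part.map_id']
  obtain ⟨G, hG, hmem⟩ := RecursiveIn.exists_merge hF' (RecursiveIn.comp hw' .left) (by
    intro p
    by_cases hp : IllFounded (treeAt p.unpair.1)
    · obtain ⟨g, -, hg⟩ := hpath _ hp
      have hval : F p.unpair = Part.some (g p.unpair.2) := hg p.unpair.2
      exact Or.inl (by simp [hval])
    · exact Or.inr (by simpa [some_bind_pfun] using (hWF p.unpair.1).1 hp))
  refine ⟨fun q => G (Nat.pair q.1 q.2), ?_, fun e he => ?_⟩
  · refine cast (congrArg (RecursiveIn (chi X)) (funext fun p => ?_)) hG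
    simp
  · obtain ⟨g, hg, hFg⟩ := hpath e he
    have heq : (fun n => G (Nat.pair e n)) = g := by
      funext n
      rcases hmem (Nat.pair e n) with h | h
      · simpa [hFg] using h
      · have h : G (Nat.pair e n) ∈ w e := by simpa [some_bind_pfun] using h
        exact absurd he ((hWF e).2 (Part.dom_iff_mem.2 ⟨_, h⟩))
    simpa only [heq] using hg

end CFT
end
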